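/- arXiv:1711.05776 — 2 statements merged into one kernel-verified Lean document; each statement's English description precedes it below -/
import Mathlib

section
/- Let k be an algebraically closed field of characteristic coprime to 6, let C = {q = 0} be a plane quartic, and let ℓ = {u₀x + v₀y + w₀z = 0} be a line such that the point [ℓ] = [u₀,v₀,w₀] is an isolated point of the inflection scheme Z = {H(q) = K(q) = 0} ⊂ P² and ℓ contains a singular point of C. Then the multiplicity of [ℓ] in Z is at least 3: the length (equivalently, the dimension as a k-vector space) of the localization, at the maximal ideal corresponding to [ℓ], of the affine coordinate ring cut out by the dehomogenizations of H(q) and K(q) in an affine chart of P² containing [ℓ] is at least 3. -/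
open MvPolynomial

noncomputable section

/-- The classical invariant `S` of a binary quartic form with coefficients `f 0, …, f 4`. -/
def Sinv {R : Type*} [CommRing R] (f : Fin 5 → R) : R :=
  12 * f 0 * f 4 - 3 * f 1 * f 3 + f 2 ^ 2

/-- The classical invariant `T` of a binary quartic form with coefficients `f 0, …, f 4`. -/
def Tinv {R : Type*} [CommRing R] (f : Fin 5 → R) : R :=
  72 * f 0 * f 2 * f 4 - 27 * f 0 * f 3 ^ 2 - 27 * f 1 ^ 2 * f 4
    + 9 * f 1 * f 2 * f 3 - 2 * f 2 ^ 3

/-- The binary quartic form `f₀ y⁴ + f₁ y³z + f₂ y²z² + f₃ yz³ + f₄ z⁴`. -/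
def binQuartic {R : Type*} [CommRing R] (f : Fin 5 → R) : MvPolynomial (Fin 2) R :=
  ∑ i : Fin 5, C (f i) * X 0 ^ (4 - (i : ℕ)) * X 1 ^ (i : ℕ)

/-- The `i`-th coefficient of a binary quartic form: coefficient of `y^(4-i) z^i`. -/
def binCoeff {R : Type*} [CommRing R] (g : MvPolynomial (Fin 2) R) (i : Fin 5) : R :=
  coeff (Finsupp.single 0 (4 - (i : ℕ)) + Finsupp.single 1 (i : ℕ)) g

/-- The substitution `g(y,z) = q(-v·y - w·z, u·y, u·z)`, a binary quartic form in `y, z` with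
coefficients in `R[u,v,w]`. -/
def gsub {R : Type*} [CommRing R] (q : MvPolynomial (Fin 3) R) :
    MvPolynomial (Fin 2) (MvPolynomial (Fin 3) R) :=
  aeval
    (![(C (- X 1) * X 0 - C (X 2) * X 1 : MvPolynomial (Fin 2) (MvPolynomial (Fin 3) R)),
       C (X 0) * X 0, C (X 0) * X 1]) q

/-- `u⁴ · H(q)`, the invariant `S` of `g(y,z) = q(-vy-wz, uy, uz)`; the harmonic quartic `H(q)`
is the form determined by `u⁴ · H(q) = SG q`. -/
def SG {R : Type*} [CommRing R] (q : MvPolynomial (Fin 3) R) : MvPolynomial (Fin 3) R :=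
  Sinv (fun i => binCoeff (gsub q) i)

/-- `u⁶ · K(q)`, the invariant `T` of `g(y,z) = q(-vy-wz, uy, uz)`; the harmonic sextic `K(q)`
is the form determined by `u⁶ · K(q) = TG q`. -/
def TG {R : Type*} [CommRing R] (q : MvPolynomial (Fin 3) R) : MvPolynomial (Fin 3) R :=
  Tinv (fun i => binCoeff (gsub q) i)

/-- dot product of two vectors in `R³`. -/
def dot3 {R : Type*} [CommRing R] (d a : Fin 3 → R) : R :=
  d 0 * a 0 + d 1 * a 1 + d 2 * a 2

/-- restriction of a ternary form to the parameterized line `(y,z) ↦ y·a + z·b`. -/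
def restrictLine {R : Type*} [CommRing R] (q : MvPolynomial (Fin 3) R) (a b : Fin 3 → R) :
    MvPolynomial (Fin 2) R :=
  aeval (fun i => C (a i) * X 0 + C (b i) * X 1) q

/-- A binary quartic form vanishes identically or has a root of multiplicity at least `3`:
`f = L³·M` with `L ≠ 0` linear and `M` linear (possibly zero). -/
def HasTripleRoot {R : Type*} [CommRing R] (f : MvPolynomial (Fin 2) R) : Prop :=
  ∃ L M : MvPolynomial (Fin 2) R,
    L.IsHomogeneous 1 ∧ M.IsHomogeneous 1 ∧ L ≠ 0 ∧ f = L ^ 3 * M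

/-- The line with dual coordinates `d` is an inflection line of the quartic `{q = 0}`. -/
def IsInflectionLine {k : Type*} [Field k] (q : MvPolynomial (Fin 3) k) (d : Fin 3 → k) :
    Prop :=
  d ≠ 0 ∧ ∃ a b : Fin 3 → k, LinearIndependent k ![a, b] ∧
    dot3 d a = 0 ∧ dot3 d b = 0 ∧ HasTripleRoot (restrictLine q a b)

/-- The line with dual coordinates `d` is a simple inflection line of `{q = 0}` with
inflection point `p`. -/
def IsSimpleInflectionLineAt {k : Type*} [Field k] (q : MvPolynomial (Fin 3) k)
    (d p : Fin 3 → k) : Prop :=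
  d ≠ 0 ∧ ∃ (a b : Fin 3 → k) (s t : k), LinearIndependent k ![a, b] ∧
    dot3 d a = 0 ∧ dot3 d b = 0 ∧ (s, t) ≠ (0, 0) ∧
    (∀ i, p i = s * a i + t * b i) ∧
    eval p q = 0 ∧ (∃ i, eval p (pderiv i q) ≠ 0) ∧
    ∃ L M : MvPolynomial (Fin 2) k, L.IsHomogeneous 1 ∧ M.IsHomogeneous 1 ∧
      LinearIndependent k ![L, M] ∧
      restrictLine q a b = L ^ 3 * M ∧ eval ![s, t] L = 0

/-- The line with dual coordinates `d` is a hyperinflection line of `{q = 0}` with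
hyperinflection point `p`. -/
def IsHyperinflectionLineAt {k : Type*} [Field k] (q : MvPolynomial (Fin 3) k)
    (d p : Fin 3 → k) : Prop :=
  d ≠ 0 ∧ ∃ (a b : Fin 3 → k) (s t : k), LinearIndependent k ![a, b] ∧
    dot3 d a = 0 ∧ dot3 d b = 0 ∧ (s, t) ≠ (0, 0) ∧
    (∀ i, p i = s * a i + t * b i) ∧
    eval p q = 0 ∧ (∃ i, eval p (pderiv i q) ≠ 0) ∧
    ∃ (c : k) (L : MvPolynomial (Fin 2) k), c ≠ 0 ∧ L.IsHomogeneous 1 ∧ L ≠ 0 ∧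
      restrictLine q a b = C c * L ^ 4 ∧ eval ![s, t] L = 0

/-- The pairing `⟨·,·⟩` between quartic forms in `x,y,z` and quartic forms in `u,v,w`:
`⟨x^i y^j z^k, u^i v^j w^k⟩ = i!j!k!/2`. -/
def pairQ {R : Type*} [CommRing R] (q h : MvPolynomial (Fin 3) R) : R :=
  ∑ m ∈ q.support,
    (((m 0).factorial * (m 1).factorial * (m 2).factorial / 2 : ℕ) : R)
      * coeff m q * coeff m h

/-- The action of `Σ c_{ξη} ξ ∂_η ∈ 𝔤𝔩₃(R)` on polynomials. -/
def lieAct {R : Type*} [CommRing R] (c : Fin 3 → Fin 3 → R)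
    (q : MvPolynomial (Fin 3) R) : MvPolynomial (Fin 3) R :=
  ∑ ξ : Fin 3, ∑ η : Fin 3, C (c ξ η) * (X ξ * pderiv η q)

/-- substitution of variables by the linear change of coordinates `M`: `q(M·(x,y,z)ᵗ)`. -/
def substM {R : Type*} [CommRing R] (M : Matrix (Fin 3) (Fin 3) R)
    (q : MvPolynomial (Fin 3) R) : MvPolynomial (Fin 3) R :=
  aeval (fun i => ∑ j : Fin 3, C (M i j) * X j) q

/-- The quartic form `q_ε = (x−y)⁴ + (x−z)⁴ + (y−εz)⁴ − (x⁴ + y⁴ + z⁴)`. -/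
def qeps {k : Type*} [CommRing k] (ε : k) : MvPolynomial (Fin 3) k :=
  (X 0 - X 1) ^ 4 + (X 0 - X 2) ^ 4 + (X 1 - C ε * X 2) ^ 4
    - (X 0 ^ 4 + X 1 ^ 4 + X 2 ^ 4)

def lineRes {k A : Type*} [CommRing k] [CommRing A] [Algebra k A] (q : MvPolynomial (Fin 3) k)
    (a b : Fin 3 → A) : MvPolynomial (Fin 2) A :=
  aeval (fun i => C (a i) * X 0 + C (b i) * X 1) q

lemma binCoeff_binQuartic {R : Type*} [CommRing R] (f : Fin 5 → R) (i : Fin 5) :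
    binCoeff (binQuartic f) i = f i := by
  have : ∀ j : Fin 5, C (f j) * X 0 ^ (4 - (j : ℕ)) * X 1 ^ (j : ℕ)
     = monomial (Finsupp.single (0 : Fin 2) (4 - (j : ℕ)) + Finsupp.single 1 (j : ℕ)) (f j) := by
    intro j
    rw [X_pow_eq_monomial, X_pow_eq_monomial, C_mul_monomial, monomial_mul]
    simp
  unfold binCoeff binQuartic
  simp only [this, coeff_sum, coeff_monomial]
  rw [Finset.sum_eq_single i]
  · simp
  · intro j _ hj
    rw [if_neg]
    intro h
    have := DFunLike.congr_fun h 1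
    simp at this
    exact hj (Fin.ext this)
  · simp

lemma homog_two {R : Type*} [CommRing R] (g : MvPolynomial (Fin 2) R) (hg : g.IsHomogeneous 4) :
    ∃ f : Fin 5 → R, g = binQuartic f := by
  refine ⟨fun i => binCoeff g i, ?_⟩
  have key : ∀ m : Fin 2 →₀ ℕ, m.degree = 4 →
      ∃ i : Fin 5, m = Finsupp.single (0 : Fin 2) (4 - (i : ℕ)) + Finsupp.single 1 (i : ℕ) := by
    intro m hm
    rw [Finsupp.degree_eq_sum, Fin.sum_univ_two] at hm
    refine ⟨⟨m 1, by omega⟩, ?_⟩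
    ext j
    fin_cases j <;> simp; omega
  ext m
  by_cases hm : m.degree = 4
  · obtain ⟨i, rfl⟩ := key m hm
    change _ = binCoeff _ i
    rw [binCoeff_binQuartic]; rfl
  · rw [hg.coeff_eq_zero hm, IsHomogeneous.coeff_eq_zero _ hm]
    refine IsHomogeneous.sum _ _ _ fun i _ => ?_
    have := ((isHomogeneous_C (Fin 2) (binCoeff g i)).mul
      ((isHomogeneous_X R (0 : Fin 2)).pow (4 - (i : ℕ)))).mul
        ((isHomogeneous_X R (1 : Fin 2)).pow (i : ℕ))
    convert this using 1
    omega

lemma homog_three {R : Type*} [CommRing R] (g : MvPolynomial (Fin 3) R) (hg : g.IsHomogeneous 4) :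
    ∃ c : ℕ → ℕ → ℕ → R, g =
      C (c 4 0 0) * X 0 ^ 4 + C (c 3 1 0) * X 0 ^ 3 * X 1 + C (c 3 0 1) * X 0 ^ 3 * X 2
      + C (c 2 2 0) * X 0 ^ 2 * X 1 ^ 2 + C (c 2 1 1) * X 0 ^ 2 * X 1 * X 2
      + C (c 2 0 2) * X 0 ^ 2 * X 2 ^ 2
      + C (c 1 3 0) * X 0 * X 1 ^ 3 + C (c 1 2 1) * X 0 * X 1 ^ 2 * X 2
      + C (c 1 1 2) * X 0 * X 1 * X 2 ^ 2 + C (c 1 0 3) * X 0 * X 2 ^ 3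
      + C (c 0 4 0) * X 1 ^ 4 + C (c 0 3 1) * X 1 ^ 3 * X 2 + C (c 0 2 2) * X 1 ^ 2 * X 2 ^ 2
      + C (c 0 1 3) * X 1 * X 2 ^ 3 + C (c 0 0 4) * X 2 ^ 4 := by
  refine ⟨fun i j l => coeff (Finsupp.equivFunOnFinite.symm ![i, j, l]) g, ?_⟩
  have h1 : g = ∑ t ∈ Finset.Nat.antidiagonalTuple 3 4,
      monomial (Finsupp.equivFunOnFinite.symm t) (coeff (Finsupp.equivFunOnFinite.symm t) g) := by
    ext m
    rw [coeff_sum]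
    simp only [coeff_monomial]
    by_cases hm : m.degree = 4
    · rw [Finset.sum_eq_single (m : Fin 3 → ℕ)]
      · simp
      · intro t _ ht
        rw [if_neg]
        rintro rfl
        simp at ht
      · intro h
        rw [Finset.Nat.mem_antidiagonalTuple] at h
        rw [Finsupp.degree_eq_sum] at hm
        exact absurd hm h
    · rw [hg.coeff_eq_zero hm, Finset.sum_eq_zero]
      intro t ht
      rw [if_neg]
      rintro rfl
      rw [Finset.Nat.mem_antidiagonalTuple] at ht
      rw [Finsupp.degree_eq_sum] at hm
      exact hm ht
  have h2 : Finset.Nat.antidiagonalTuple 3 4 = {![4,0,0], ![3,1,0], ![3,0,1], ![2,2,0], ![2,1,1],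
     ![2,0,2], ![1,3,0], ![1,2,1], ![1,1,2], ![1,0,3], ![0,4,0], ![0,3,1], ![0,2,2], ![0,1,3],
     ![0,0,4]} := by decide
  have h3 : ∀ (i j l : ℕ) (r : R), monomial (Finsupp.equivFunOnFinite.symm ![i, j, l]) r
      = C r * X 0 ^ i * X 1 ^ j * X 2 ^ l := by
    intro i j l r
    rw [X_pow_eq_monomial, X_pow_eq_monomial, X_pow_eq_monomial, C_mul_monomial, monomial_mul,
      monomial_mul]
    simp only [mul_one]
    refine congrArg (fun z => monomial z r) ?_
    ext x
    fin_cases x <;> simp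
  rw [h2] at h1
  repeat rw [Finset.sum_insert (by decide)] at h1
  rw [Finset.sum_singleton] at h1
  simp only [h3] at h1
  refine h1.trans ?_
  ring

lemma binCoeff_map {R S : Type*} [CommRing R] [CommRing S] (ψ : R →+* S)
    (g : MvPolynomial (Fin 2) R) (i : Fin 5) : binCoeff (map ψ g) i = ψ (binCoeff g i) := by
  simp [binCoeff, coeff_map]

lemma lineRes_map {k A B : Type*} [CommRing k] [CommRing A] [Algebra k A] [CommRing B] [Algebra k B]
    (ψ : A →ₐ[k] B) (q : MvPolynomial (Fin 3) k) (a b : Fin 3 → A) :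
    map (ψ : A →+* B) (lineRes q a b) = lineRes q (fun i => ψ (a i)) (fun i => ψ (b i)) := by
  unfold lineRes
  induction q using MvPolynomial.induction_on with
  | C r => simp [MvPolynomial.algebraMap_apply]
  | add p q hp hq => simp only [map_add, hp, hq]
  | mul_X p i hp => simp only [map_mul, hp, aeval_X]; simp

lemma lineRes_homog {k A : Type*} [CommRing k] [CommRing A] [Algebra k A]
    (q : MvPolynomial (Fin 3) k) (hq : q.IsHomogeneous 4) (a b : Fin 3 → A) :
    (lineRes q a b).IsHomogeneous 4 := by
  unfold lineRes
  have := hq.aeval (fun i => C (a i) * X 0 + C (b i) * X 1 : Fin 3 → MvPolynomial (Fin 2) A)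
    (n := 1) (by
      intro i
      have h : ∀ (r : A) (j : Fin 2), (C r * X j : MvPolynomial (Fin 2) A).IsHomogeneous 1 := by
        intro r j
        simpa using (isHomogeneous_C (Fin 2) r).mul (isHomogeneous_X A j)
      exact (h _ _).add (h _ _))
  simpa using this

lemma binQuartic_sub {R : Type*} [CommRing R] (f : Fin 5 → R) (α β γ δ : R) :
    aeval ![C α * X 0 + C β * X 1, C γ * X 0 + C δ * X 1] (binQuartic f) =
     (binQuartic ![
      f 0*α^4 + f 1*α^3*γ + f 2*α^2*γ^2 + f 3*α*γ^3 + f 4*γ^4,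
      4*f 0*α^3*β + f 1*(α^3*δ + 3*α^2*β*γ) + f 2*(2*α^2*γ*δ + 2*α*β*γ^2)
        + f 3*(3*α*γ^2*δ + β*γ^3) + 4*f 4*γ^3*δ,
      6*f 0*α^2*β^2 + f 1*(3*α^2*β*δ + 3*α*β^2*γ) + f 2*(α^2*δ^2 + 4*α*β*γ*δ + β^2*γ^2)
        + f 3*(3*α*γ*δ^2 + 3*β*γ^2*δ) + 6*f 4*γ^2*δ^2,
      4*f 0*α*β^3 + f 1*(3*α*β^2*δ + β^3*γ) + f 2*(2*α*β*δ^2 + 2*β^2*γ*δ)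
        + f 3*(α*δ^3 + 3*β*γ*δ^2) + 4*f 4*γ*δ^3,
      f 0*β^4 + f 1*β^3*δ + f 2*β^2*δ^2 + f 3*β*δ^3 + f 4*δ^4] : MvPolynomial (Fin 2) R) := by
  simp only [binQuartic, Fin.sum_univ_five]
  simp [algebraMap_eq]
  simp only [show (C 4 : MvPolynomial (Fin 2) R) = 4 from rfl, show (C 2 : MvPolynomial (Fin 2) R) = 2 from rfl, show (C 3 : MvPolynomial (Fin 2) R) = 3 from rfl, show (C 6 : MvPolynomial (Fin 2) R) = 6 from rfl]
  ring

lemma inv_sub {R : Type*} [CommRing R] (g : MvPolynomial (Fin 2) R) (hg : g.IsHomogeneous 4)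
    (α β γ δ : R) :
    Sinv (fun i => binCoeff
      (aeval ![C α * X 0 + C β * X 1, C γ * X 0 + C δ * X 1] g : MvPolynomial (Fin 2) R) i)
      = (α * δ - β * γ) ^ 4 * Sinv (fun i => binCoeff g i) ∧
    Tinv (fun i => binCoeff
      (aeval ![C α * X 0 + C β * X 1, C γ * X 0 + C δ * X 1] g : MvPolynomial (Fin 2) R) i)
      = (α * δ - β * γ) ^ 6 * Tinv (fun i => binCoeff g i) := by
  obtain ⟨f, rfl⟩ := homog_two g hg
  rw [binQuartic_sub]
  simp only [binCoeff_binQuartic]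
  constructor
  · simp [Sinv]; ring
  · simp [Tinv]; ring

def crossv {A : Type*} [CommRing A] (a b : Fin 3 → A) : Fin 3 → A :=
  ![a 1 * b 2 - a 2 * b 1, a 2 * b 0 - a 0 * b 2, a 0 * b 1 - a 1 * b 0]

lemma Sinv_map {R S : Type*} [CommRing R] [CommRing S] (ψ : R →+* S) (f : Fin 5 → R) :
    ψ (Sinv f) = Sinv (fun i => ψ (f i)) := by
  simp only [Sinv, map_add, map_sub, map_mul, map_pow, map_ofNat]

lemma Tinv_map {R S : Type*} [CommRing R] [CommRing S] (ψ : R →+* S) (f : Fin 5 → R) :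
    ψ (Tinv f) = Tinv (fun i => ψ (f i)) := by
  simp only [Tinv, map_add, map_sub, map_mul, map_pow, map_ofNat]

lemma C_sub_aux {R : Type*} [CommRing R] (x y : R) :
    (C x * X 0 - C y * X 1 : MvPolynomial (Fin 2) R) = C x * X 0 + C (-y) * X 1 := by
  rw [C_neg, neg_mul, sub_eq_add_neg]

lemma gsub_eq {k : Type*} [CommRing k] (q : MvPolynomial (Fin 3) k) :
    gsub q = lineRes q ![-X 1, X 0, 0] ![-X 2, 0, X 0] := by
  unfold gsub lineRes
  have : (![(C (- X 1) * X 0 - C (X 2) * X 1 : MvPolynomial (Fin 2) (MvPolynomial (Fin 3) k)),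
       C (X 0) * X 0, C (X 0) * X 1]) = fun i => C ((![-X 1, X 0, 0] : Fin 3 → MvPolynomial (Fin 3) k) i) * X 0 +
        C ((![-X 2, 0, X 0] : Fin 3 → MvPolynomial (Fin 3) k) i) * X 1 := by
    ext1 i
    fin_cases i
    · exact C_sub_aux _ _
    · simp
    · simp
  rw [this]

lemma aeval_aeval_tower {k A σ τ E : Type*} [CommRing k] [CommRing A] [Algebra k A] [CommRing E]
    [Algebra k E] [Algebra A E] [IsScalarTower k A E]
    (g : τ → E) (f : σ → MvPolynomial τ A) (q : MvPolynomial σ k) :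
    aeval g (aeval f q) = aeval (fun i => aeval g (f i)) q := by
  exact comp_aeval_apply f ((aeval g : MvPolynomial τ A →ₐ[A] E).restrictScalars k) q

/-- weak covariance -/
lemma cov_weak {k A : Type*} [Field k] [CommRing A] [Algebra k A]
    (q : MvPolynomial (Fin 3) k) (hq4 : q.IsHomogeneous 4)
    (H K : MvPolynomial (Fin 3) k)
    (hH : X 0 ^ 4 * H = SG q) (hK : X 0 ^ 6 * K = TG q) (a b : Fin 3 → A) :
    (crossv a b 0) ^ 4 * aeval (crossv a b) H =
      (crossv a b 0) ^ 4 * Sinv (fun i => binCoeff (lineRes q a b) i) ∧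
    (crossv a b 0) ^ 6 * aeval (crossv a b) K =
      (crossv a b 0) ^ 6 * Tinv (fun i => binCoeff (lineRes q a b) i) := by
  set ψ : MvPolynomial (Fin 3) k →ₐ[k] A := aeval (crossv a b) with hψ
  have e : map (ψ : MvPolynomial (Fin 3) k →+* A) (gsub q) =
      aeval ![C (b 2) * X 0 + C (- b 1) * X 1, C (- a 2) * X 0 + C (a 1) * X 1]
        (lineRes q a b) := by
    rw [gsub_eq, lineRes_map]
    unfold lineRes
    rw [aeval_aeval_tower]
    refine congrArg (fun z => aeval z q) ?_
    funext i
    fin_cases i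
    · simp [hψ, crossv, algebraMap_eq]; ring
    · simp [hψ, crossv, algebraMap_eq]; ring
    · simp [hψ, crossv, algebraMap_eq]; ring
  have e2 := congrArg ψ hH
  have e3 := congrArg ψ hK
  have dd : b 2 * a 1 - (- b 1) * (- a 2) = crossv a b 0 := by simp [crossv]; ring
  have := inv_sub (lineRes q a b) (lineRes_homog q hq4 a b) (b 2) (- b 1) (- a 2) (a 1)
  rw [dd, ← e] at this
  simp only [binCoeff_map] at this
  rw [← this.1, ← this.2]
  simp only [SG, TG] at e2 e3
  constructor
  · have h := Sinv_map (ψ : MvPolynomial (Fin 3) k →+* A) (fun i => binCoeff (gsub q) i)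
    rw [← h]
    refine Eq.trans ?_ e2
    simp [hψ]
  · have h := Tinv_map (ψ : MvPolynomial (Fin 3) k →+* A) (fun i => binCoeff (gsub q) i)
    rw [← h]
    refine Eq.trans ?_ e3
    simp [hψ]

lemma cov {k A : Type*} [Field k] [CommRing A] [Algebra k A]
    (q : MvPolynomial (Fin 3) k) (hq4 : q.IsHomogeneous 4)
    (H K : MvPolynomial (Fin 3) k)
    (hH : X 0 ^ 4 * H = SG q) (hK : X 0 ^ 6 * K = TG q) (a b : Fin 3 → A) :
    aeval (crossv a b) H = Sinv (fun i => binCoeff (lineRes q a b) i) ∧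
    aeval (crossv a b) K = Tinv (fun i => binCoeff (lineRes q a b) i) := by
  let a' : Fin 3 → MvPolynomial (Fin 2 × Fin 3) k := fun i => X (0, i)
  let b' : Fin 3 → MvPolynomial (Fin 2 × Fin 3) k := fun i => X (1, i)
  have h0 : crossv a' b' 0 ≠ 0 := by
    intro h
    have := congrArg (eval (fun x : Fin 2 × Fin 3 => if x = (0,1) ∨ x = (1,2) then (1 : k) else 0)) h
    simp [crossv, a', b'] at this
  obtain ⟨h1, h2⟩ := cov_weak q hq4 H K hH hK a' b'
  replace h1 := mul_left_cancel₀ (pow_ne_zero _ h0) h1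
  replace h2 := mul_left_cancel₀ (pow_ne_zero _ h0) h2
  let ψ : MvPolynomial (Fin 2 × Fin 3) k →ₐ[k] A :=
    aeval (fun x => if x.1 = 0 then a x.2 else b x.2)
  have ha : (fun i => ψ (a' i)) = a := by ext i; simp [ψ, a']
  have hb : (fun i => ψ (b' i)) = b := by ext i; simp [ψ, b']
  have hc : ∀ G : MvPolynomial (Fin 3) k, ψ (aeval (crossv a' b') G) = aeval (crossv a b) G := by
    intro G
    rw [comp_aeval_apply]
    refine congrArg (fun z => aeval z G) ?_
    funext i
    rw [← ha, ← hb]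
    fin_cases i <;> simp [crossv]
  have hf : ∀ i, ψ (binCoeff (lineRes q a' b') i) = binCoeff (lineRes q a b) i := by
    intro i
    have := binCoeff_map (ψ : MvPolynomial (Fin 2 × Fin 3) k →+* A) (lineRes q a' b') i
    rw [lineRes_map, ha, hb] at this
    exact this.symm
  constructor
  · rw [← hc, h1]
    have := Sinv_map (ψ : MvPolynomial (Fin 2 × Fin 3) k →+* A) (fun i => binCoeff (lineRes q a' b') i)
    refine Eq.trans this ?_
    congr 1; ext i; exact hf i
  · rw [← hc, h2]
    have := Tinv_map (ψ : MvPolynomial (Fin 2 × Fin 3) k →+* A) (fun i => binCoeff (lineRes q a' b') i)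
    refine Eq.trans this ?_
    congr 1; ext i; exact hf i

lemma pderiv_chain {k : Type*} [CommRing k] (f : Fin 3 → MvPolynomial (Fin 3) k)
    (q : MvPolynomial (Fin 3) k) (j : Fin 3) :
    pderiv j (aeval f q) = ∑ i, aeval f (pderiv i q) * pderiv j (f i) := by
  induction q using MvPolynomial.induction_on with
  | C r => simp [algebraMap_eq]
  | add p q hp hq => simp only [map_add, hp, hq, add_mul, Finset.sum_add_distrib]
  | mul_X p i hp =>
    simp only [map_mul, Derivation.leibniz, hp, aeval_X, smul_eq_mul, map_add, add_mul,
      Finset.sum_add_distrib, pderiv_X, Finset.mul_sum]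
    congr 1
    · rw [Finset.sum_eq_single i]
      · simp
      · intro b _ hb
        simp [Pi.single_apply, Ne.symm hb]
      · simp
    · refine Finset.sum_congr rfl fun x _ => by ring

/-- The coefficients of a quartic in coordinates adapted to a singular point `p`. -/
lemma localForm {k : Type*} [Field k]
    (q : MvPolynomial (Fin 3) k) (hq4 : q.IsHomogeneous 4) (p b e : Fin 3 → k)
    (h0 : eval p q = 0) (h1 : ∀ i, eval p (pderiv i q) = 0) :
    ∃ c : ℕ → ℕ → ℕ → k,
      aeval (fun i => C (p i) * X 0 + C (b i) * X 1 + C (e i) * X 2 :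
        Fin 3 → MvPolynomial (Fin 3) k) q =
      C (c 2 2 0) * X 0 ^ 2 * X 1 ^ 2 + C (c 2 1 1) * X 0 ^ 2 * X 1 * X 2
      + C (c 2 0 2) * X 0 ^ 2 * X 2 ^ 2
      + C (c 1 3 0) * X 0 * X 1 ^ 3 + C (c 1 2 1) * X 0 * X 1 ^ 2 * X 2
      + C (c 1 1 2) * X 0 * X 1 * X 2 ^ 2 + C (c 1 0 3) * X 0 * X 2 ^ 3
      + C (c 0 4 0) * X 1 ^ 4 + C (c 0 3 1) * X 1 ^ 3 * X 2 + C (c 0 2 2) * X 1 ^ 2 * X 2 ^ 2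
      + C (c 0 1 3) * X 1 * X 2 ^ 3 + C (c 0 0 4) * X 2 ^ 4 := by
  set f : Fin 3 → MvPolynomial (Fin 3) k :=
    fun i => C (p i) * X 0 + C (b i) * X 1 + C (e i) * X 2 with hf
  have hh : (aeval f q).IsHomogeneous 4 := by
    have := hq4.aeval f (n := 1) (by
      intro i
      have h : ∀ (r : k) (j : Fin 3), (C r * X j : MvPolynomial (Fin 3) k).IsHomogeneous 1 := by
        intro r j
        simpa using (isHomogeneous_C (Fin 3) r).mul (isHomogeneous_X k j)
      exact ((h _ _).add (h _ _)).add (h _ _))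
    simpa using this
  obtain ⟨c, hc⟩ := homog_three _ hh
  have hev : ∀ G : MvPolynomial (Fin 3) k, eval ![1, 0, 0] (aeval f G) = eval p G := by
    intro G
    have := aeval_aeval_tower (![1, 0, 0] : Fin 3 → k) f G
    rw [← coe_aeval_eq_eval, ← coe_aeval_eq_eval]
    refine this.trans ?_
    refine congrArg (fun z => aeval z G) ?_
    funext i
    simp [hf]
  have hpd : ∀ j, eval ![1, 0, 0] (pderiv j (aeval f q)) = 0 := by
    intro j
    rw [pderiv_chain, map_sum]
    refine Finset.sum_eq_zero fun i _ => ?_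
    rw [map_mul, hev, h1, zero_mul]
  have e0 : c 4 0 0 = 0 := by
    have := hev q
    rw [hc, h0] at this
    simpa using this
  have e1 : c 3 1 0 = 0 := by
    have := hpd 1
    rw [hc] at this
    simpa [pderiv_X, Pi.single_apply] using this
  have e2 : c 3 0 1 = 0 := by
    have := hpd 2
    rw [hc] at this
    simpa [pderiv_X, Pi.single_apply] using this
  refine ⟨c, ?_⟩
  rw [hc, e0, e1, e2]
  simp

lemma lineRes_local {k A : Type*} [Field k] [CommRing A] [Algebra k A]
    (q : MvPolynomial (Fin 3) k) (p b e : Fin 3 → k) (c : ℕ → ℕ → ℕ → k)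
    (hc : aeval (fun i => C (p i) * X 0 + C (b i) * X 1 + C (e i) * X 2 :
        Fin 3 → MvPolynomial (Fin 3) k) q =
      C (c 2 2 0) * X 0 ^ 2 * X 1 ^ 2 + C (c 2 1 1) * X 0 ^ 2 * X 1 * X 2
      + C (c 2 0 2) * X 0 ^ 2 * X 2 ^ 2
      + C (c 1 3 0) * X 0 * X 1 ^ 3 + C (c 1 2 1) * X 0 * X 1 ^ 2 * X 2
      + C (c 1 1 2) * X 0 * X 1 * X 2 ^ 2 + C (c 1 0 3) * X 0 * X 2 ^ 3
      + C (c 0 4 0) * X 1 ^ 4 + C (c 0 3 1) * X 1 ^ 3 * X 2 + C (c 0 2 2) * X 1 ^ 2 * X 2 ^ 2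
      + C (c 0 1 3) * X 1 * X 2 ^ 3 + C (c 0 0 4) * X 2 ^ 4)
    (g : ℕ → ℕ → ℕ → A) (hg : ∀ i j l, g i j l = algebraMap k A (c i j l)) (s t : A) :
    lineRes q (fun i => algebraMap k A (p i) + s * algebraMap k A (e i))
      (fun i => algebraMap k A (b i) + t * algebraMap k A (e i)) =
    binQuartic ![g 2 0 2 * s ^ 2 + g 1 0 3 * s ^ 3 + g 0 0 4 * s ^ 4,
      g 2 1 1 * s + 2 * g 2 0 2 * s * t + g 1 1 2 * s ^ 2 + 3 * g 1 0 3 * s ^ 2 * t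
        + g 0 1 3 * s ^ 3 + 4 * g 0 0 4 * s ^ 3 * t,
      g 2 2 0 + g 2 1 1 * t + g 2 0 2 * t ^ 2 + g 1 2 1 * s + 2 * g 1 1 2 * s * t
        + 3 * g 1 0 3 * s * t ^ 2 + g 0 2 2 * s ^ 2 + 3 * g 0 1 3 * s ^ 2 * t
        + 6 * g 0 0 4 * s ^ 2 * t ^ 2,
      g 1 3 0 + g 1 2 1 * t + g 1 1 2 * t ^ 2 + g 1 0 3 * t ^ 3 + g 0 3 1 * s
        + 2 * g 0 2 2 * s * t + 3 * g 0 1 3 * s * t ^ 2 + 4 * g 0 0 4 * s * t ^ 3,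
      g 0 4 0 + g 0 3 1 * t + g 0 2 2 * t ^ 2 + g 0 1 3 * t ^ 3 + g 0 0 4 * t ^ 4] := by
  have h : lineRes q (fun i => algebraMap k A (p i) + s * algebraMap k A (e i))
      (fun i => algebraMap k A (b i) + t * algebraMap k A (e i)) =
      aeval (![X 0, X 1, C s * X 0 + C t * X 1] : Fin 3 → MvPolynomial (Fin 2) A)
      (aeval (fun i => C (p i) * X 0 + C (b i) * X 1 + C (e i) * X 2 :
        Fin 3 → MvPolynomial (Fin 3) k) q) := by
    rw [aeval_aeval_tower]
    unfold lineRes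
    refine congrArg (fun z => aeval z q) ?_
    funext i
    simp [MvPolynomial.algebraMap_apply]
    ring
  rw [h, hc]
  simp only [binQuartic, Fin.sum_univ_five]
  simp [MvPolynomial.algebraMap_apply, ← hg]
  simp only [show (C 4 : MvPolynomial (Fin 2) A) = 4 from rfl,
    show (C 2 : MvPolynomial (Fin 2) A) = 2 from rfl,
    show (C 3 : MvPolynomial (Fin 2) A) = 3 from rfl,
    show (C 6 : MvPolynomial (Fin 2) A) = 6 from rfl]
  ring

/-- Abstract criterion for the local multiplicity being at least `3`. -/
lemma rank_crit {k : Type*} [Field k]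
    (H K : MvPolynomial (Fin 3) k) (d : Fin 3 → k) (i₀ : Fin 3)
    (J : Ideal (MvPolynomial (Fin 3) k))
    (hJ : J = Ideal.span {H, K, X i₀ - 1})
    (P : Ideal (MvPolynomial (Fin 3) k ⧸ J)) [P.IsPrime]
    (hP : P = Ideal.map (Ideal.Quotient.mk J) (RingHom.ker (eval d)))
    (B : Type*) [CommRing B] [Algebra (MvPolynomial (Fin 3) k ⧸ J) B]
    [IsLocalization.AtPrime B P]
    [Algebra k B] [IsScalarTower k (MvPolynomial (Fin 3) k ⧸ J) B]
    {A : Type*} [CommRing A] [Algebra k A] (D : Fin 3 → A)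
    (hD : ∀ i, IsNilpotent (D i - algebraMap k A (d i)))
    (hH : aeval D H = 0) (hK : aeval D K = 0) (hi : D i₀ = 1)
    (v : Fin 3 → MvPolynomial (Fin 3) k)
    (hv : LinearIndependent k (fun i => aeval D (v i))) :
    3 ≤ Module.rank k B := by
  let φ : MvPolynomial (Fin 3) k →ₐ[k] A := aeval D
  have hJφ : ∀ x ∈ J, φ x = 0 := by
    intro x hx
    have : J ≤ RingHom.ker φ := by
      rw [hJ, Ideal.span_le]
      rintro y (rfl | rfl | rfl)
      · exact hH
      · exact hK
      · simp [φ, hi]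
    exact this hx
  let φ' : MvPolynomial (Fin 3) k ⧸ J →ₐ[k] A := Ideal.Quotient.liftₐ J φ hJφ
  have hnil : ∀ r, IsNilpotent (φ r - algebraMap k A (eval d r)) := by
    intro r
    induction r using MvPolynomial.induction_on with
    | C r => simp [φ]
    | add p q hp hq =>
      have := (Commute.all _ _).isNilpotent_add hp hq
      convert this using 1
      simp; ring
    | mul_X p i hp =>
      have h1 := (Commute.all (D i) _).isNilpotent_mul_left hp
      have h2 := (Commute.all (algebraMap k A (eval d p)) _).isNilpotent_mul_left (hD i)
      have := (Commute.all _ _).isNilpotent_add h1 h2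
      convert this using 1
      simp [φ]; ring
  have hunit : ∀ y : P.primeCompl, IsUnit ((φ' : MvPolynomial (Fin 3) k ⧸ J →+* A) y) := by
    rintro ⟨y, hy⟩
    obtain ⟨r, rfl⟩ := Ideal.Quotient.mk_surjective y
    have hr : eval d r ≠ 0 := by
      intro h
      apply hy
      rw [hP]
      exact Ideal.mem_map_of_mem _ h
    have hu : IsUnit (algebraMap k A (eval d r)) := (IsUnit.mk0 _ hr).map _
    have := (hnil r).isUnit_add_right_of_commute hu (Commute.all _ _)
    rw [sub_add_cancel] at this
    exact this
  let Φ : B →+* A := IsLocalization.lift (M := P.primeCompl) (S := B) hunit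
  have hΦ : ∀ x : MvPolynomial (Fin 3) k ⧸ J,
      Φ (algebraMap _ B x) = φ' x := fun x => IsLocalization.lift_eq hunit x
  let Ψ : B →ₐ[k] A := { Φ with
    commutes' := by
      intro c
      change Φ (algebraMap k B c) = _
      rw [IsScalarTower.algebraMap_apply k (MvPolynomial (Fin 3) k ⧸ J) B, hΦ]
      simp }
  have hli : LinearIndependent k
      (fun i => algebraMap (MvPolynomial (Fin 3) k ⧸ J) B (Ideal.Quotient.mk J (v i))) := by
    refine LinearIndependent.of_comp Ψ.toLinearMap ?_
    convert hv using 1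
    funext i
    change Φ _ = _
    simp only [hΦ]
    rfl
  simpa using hli.cardinal_lift_le_rank

lemma exists_cross {k : Type*} [Field k] (d p : Fin 3 → k) (hp : p ≠ 0) (h : dot3 d p = 0) :
    ∃ b, crossv p b = d := by
  unfold dot3 at h
  by_cases h0 : p 0 = 0
  · by_cases h1 : p 1 = 0
    · have h2 : p 2 ≠ 0 := by
        intro h2
        apply hp
        funext i
        fin_cases i <;> assumption
      refine ⟨![d 1 / p 2, - d 0 / p 2, 0], ?_⟩
      have : d 2 = 0 := by simpa [h0, h1, h2] using h
      funext i
      fin_cases i <;> simp [crossv, h0, h1, this] <;> field_simp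
    · refine ⟨![- d 2 / p 1, 0, d 0 / p 1], ?_⟩
      funext i
      fin_cases i <;> simp [crossv, h0] <;> field_simp
      simp only [h0] at h
      linear_combination -h
  · refine ⟨![0, d 2 / p 0, - d 1 / p 0], ?_⟩
    funext i
    fin_cases i <;> simp [crossv] <;> field_simp
    linear_combination -h

lemma inv_local {k A : Type*} [Field k] [CommRing A] [Algebra k A]
    (q : MvPolynomial (Fin 3) k) (hq4 : q.IsHomogeneous 4)
    (H K : MvPolynomial (Fin 3) k)
    (hH : X 0 ^ 4 * H = SG q) (hK : X 0 ^ 6 * K = TG q)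
    (p b e : Fin 3 → k) (c : ℕ → ℕ → ℕ → k)
    (hc : aeval (fun i => C (p i) * X 0 + C (b i) * X 1 + C (e i) * X 2 :
        Fin 3 → MvPolynomial (Fin 3) k) q =
      C (c 2 2 0) * X 0 ^ 2 * X 1 ^ 2 + C (c 2 1 1) * X 0 ^ 2 * X 1 * X 2
      + C (c 2 0 2) * X 0 ^ 2 * X 2 ^ 2
      + C (c 1 3 0) * X 0 * X 1 ^ 3 + C (c 1 2 1) * X 0 * X 1 ^ 2 * X 2
      + C (c 1 1 2) * X 0 * X 1 * X 2 ^ 2 + C (c 1 0 3) * X 0 * X 2 ^ 3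
      + C (c 0 4 0) * X 1 ^ 4 + C (c 0 3 1) * X 1 ^ 3 * X 2 + C (c 0 2 2) * X 1 ^ 2 * X 2 ^ 2
      + C (c 0 1 3) * X 1 * X 2 ^ 3 + C (c 0 0 4) * X 2 ^ 4)
    (hγ : c 2 2 0 = 0)
    (s t : A) (hs : s ^ 2 = 0) (hst : s * t = 0) (ht : t ^ 3 = 0) :
    aeval (crossv (fun i => algebraMap k A (p i) + s * algebraMap k A (e i))
      (fun i => algebraMap k A (b i) + t * algebraMap k A (e i))) H =
      algebraMap k A (c 2 1 1) ^ 2 * t ^ 2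
        - 3 * algebraMap k A (c 2 1 1) * algebraMap k A (c 1 3 0) * s ∧
    aeval (crossv (fun i => algebraMap k A (p i) + s * algebraMap k A (e i))
      (fun i => algebraMap k A (b i) + t * algebraMap k A (e i))) K = 0 := by
  obtain ⟨h1, h2⟩ := cov q hq4 H K hH hK
    (fun i => algebraMap k A (p i) + s * algebraMap k A (e i))
    (fun i => algebraMap k A (b i) + t * algebraMap k A (e i))
  rw [h1, h2]
  clear h1 h2
  rw [lineRes_local q p b e c hc (fun i j l => algebraMap k A (c i j l)) (fun _ _ _ => rfl) s t]
  simp only [binCoeff_binQuartic]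
  generalize hg : (fun i j l => algebraMap k A (c i j l)) = g
  have hgc : ∀ i j l, algebraMap k A (c i j l) = g i j l := by intro i j l; rw [← hg]
  have hγ' : g 2 2 0 = 0 := by rw [← hgc, hγ, map_zero]
  simp only [hgc]
  have hf0 : g 2 0 2 * s ^ 2 + g 1 0 3 * s ^ 3 + g 0 0 4 * s ^ 4 = 0 := by
    linear_combination (g 2 0 2 + g 1 0 3 * s + g 0 0 4 * s ^ 2) * hs
  have hf1 : g 2 1 1 * s + 2 * g 2 0 2 * s * t + g 1 1 2 * s ^ 2 + 3 * g 1 0 3 * s ^ 2 * t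
        + g 0 1 3 * s ^ 3 + 4 * g 0 0 4 * s ^ 3 * t = g 2 1 1 * s := by
    linear_combination (2 * g 2 0 2 + 3 * g 1 0 3 * s + 4 * g 0 0 4 * s ^ 2) * hst
      + (g 1 1 2 + g 0 1 3 * s) * hs
  have hf2 : g 2 2 0 + g 2 1 1 * t + g 2 0 2 * t ^ 2 + g 1 2 1 * s + 2 * g 1 1 2 * s * t
        + 3 * g 1 0 3 * s * t ^ 2 + g 0 2 2 * s ^ 2 + 3 * g 0 1 3 * s ^ 2 * t
        + 6 * g 0 0 4 * s ^ 2 * t ^ 2 = g 2 1 1 * t + g 2 0 2 * t ^ 2 + g 1 2 1 * s := by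
    linear_combination (2 * g 1 1 2 + 3 * g 1 0 3 * t + 3 * g 0 1 3 * s + 6 * g 0 0 4 * s * t) * hst
      + g 0 2 2 * hs + hγ'
  have hf3 : s * (g 1 3 0 + g 1 2 1 * t + g 1 1 2 * t ^ 2 + g 1 0 3 * t ^ 3 + g 0 3 1 * s
        + 2 * g 0 2 2 * s * t + 3 * g 0 1 3 * s * t ^ 2 + 4 * g 0 0 4 * s * t ^ 3)
        = s * g 1 3 0 := by
    linear_combination (g 1 2 1 + g 1 1 2 * t + g 1 0 3 * t ^ 2 + 2 * g 0 2 2 * s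
      + 3 * g 0 1 3 * s * t + 4 * g 0 0 4 * s * t ^ 2) * hst + g 0 3 1 * hs
  rw [hf0, hf1, hf2]
  generalize g 1 3 0 + g 1 2 1 * t + g 1 1 2 * t ^ 2 + g 1 0 3 * t ^ 3 + g 0 3 1 * s
        + 2 * g 0 2 2 * s * t + 3 * g 0 1 3 * s * t ^ 2 + 4 * g 0 0 4 * s * t ^ 3 = f3 at *
  generalize g 0 4 0 + g 0 3 1 * t + g 0 2 2 * t ^ 2 + g 0 1 3 * t ^ 3 + g 0 0 4 * t ^ 4 = f4
  have hq2 : (g 2 1 1 * t + g 2 0 2 * t ^ 2 + g 1 2 1 * s) ^ 2 = g 2 1 1 ^ 2 * t ^ 2 := by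
    linear_combination (2 * g 2 1 1 * g 2 0 2 + g 2 0 2 ^ 2 * t) * ht
      + (2 * g 2 1 1 * g 1 2 1 + 2 * g 2 0 2 * g 1 2 1 * t) * hst + g 1 2 1 ^ 2 * hs
  have hq3 : (g 2 1 1 * t + g 2 0 2 * t ^ 2 + g 1 2 1 * s) ^ 3 = 0 := by
    rw [pow_succ, hq2]
    linear_combination (g 2 1 1 ^ 3 + g 2 1 1 ^ 2 * g 2 0 2 * t) * ht
      + g 2 1 1 ^ 2 * g 1 2 1 * t * hst
  have hq1 : s * (g 2 1 1 * t + g 2 0 2 * t ^ 2 + g 1 2 1 * s) = 0 := by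
    linear_combination (g 2 1 1 + g 2 0 2 * t) * hst + g 1 2 1 * hs
  generalize g 2 1 1 * t + g 2 0 2 * t ^ 2 + g 1 2 1 * s = f2 at *
  constructor
  · simp [Sinv]
    linear_combination hq2 - 3 * g 2 1 1 * hf3
  · simp [Tinv]
    linear_combination -27 * g 2 1 1 ^ 2 * f4 * hs + 9 * g 2 1 1 * f3 * hq1 - 2 * hq3

lemma inv_base {k : Type*} [Field k]
    (q : MvPolynomial (Fin 3) k) (hq4 : q.IsHomogeneous 4)
    (H K : MvPolynomial (Fin 3) k)
    (hH : X 0 ^ 4 * H = SG q) (hK : X 0 ^ 6 * K = TG q)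
    (p b e : Fin 3 → k) (c : ℕ → ℕ → ℕ → k)
    (hc : aeval (fun i => C (p i) * X 0 + C (b i) * X 1 + C (e i) * X 2 :
        Fin 3 → MvPolynomial (Fin 3) k) q =
      C (c 2 2 0) * X 0 ^ 2 * X 1 ^ 2 + C (c 2 1 1) * X 0 ^ 2 * X 1 * X 2
      + C (c 2 0 2) * X 0 ^ 2 * X 2 ^ 2
      + C (c 1 3 0) * X 0 * X 1 ^ 3 + C (c 1 2 1) * X 0 * X 1 ^ 2 * X 2
      + C (c 1 1 2) * X 0 * X 1 * X 2 ^ 2 + C (c 1 0 3) * X 0 * X 2 ^ 3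
      + C (c 0 4 0) * X 1 ^ 4 + C (c 0 3 1) * X 1 ^ 3 * X 2 + C (c 0 2 2) * X 1 ^ 2 * X 2 ^ 2
      + C (c 0 1 3) * X 1 * X 2 ^ 3 + C (c 0 0 4) * X 2 ^ 4)
    (hZ : eval (crossv p b) H = 0) : c 2 2 0 = 0 := by
  obtain ⟨h1, -⟩ := cov q hq4 H K hH hK p b
  have := lineRes_local (A := k) q p b e c hc c (fun _ _ _ => rfl) 0 0
  simp only [zero_mul, add_zero, Algebra.algebraMap_self, RingHom.id_apply] at this
  rw [this] at h1
  simp only [binCoeff_binQuartic] at h1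
  rw [← coe_aeval_eq_eval] at hZ
  replace h1 := hZ.symm.trans h1
  simpa [Sinv] using h1.symm

lemma cross_facts {k A : Type*} [Field k] [CommRing A] [Algebra k A]
    (d p b : Fin 3 → k) (i₀ : Fin 3) (hd : crossv p b = d) (hi : d i₀ = 1) (s t : A)
    (hs : s ^ 2 = 0) (ht : t ^ 3 = 0)
    (D : Fin 3 → A)
    (hD : D = crossv (fun i => algebraMap k A (p i) + s * algebraMap k A ((Pi.single i₀ (1 : k) : Fin 3 → k) i))
      (fun i => algebraMap k A (b i) + t * algebraMap k A ((Pi.single i₀ (1 : k) : Fin 3 → k) i))) :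
    D i₀ = 1 ∧ (∀ i, IsNilpotent (D i - algebraMap k A (d i))) ∧
    aeval D (- ∑ i, C (p i) * X i) = s ∧ aeval D (- ∑ i, C (b i) * X i) = t := by
  have hn : ∀ x y : A, IsNilpotent (s * x + t * y) := fun x y =>
    (Commute.all _ _).isNilpotent_add ((Commute.all _ _).isNilpotent_mul_right ⟨2, hs⟩)
      ((Commute.all _ _).isNilpotent_mul_right ⟨3, ht⟩)
  have h1 : algebraMap k A (d i₀) = 1 := by rw [hi, map_one]
  subst hd
  subst hD
  generalize hx : (fun i => algebraMap k A (p i)) = x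
  generalize hy : (fun i => algebraMap k A (b i)) = y
  have hx' : ∀ i, algebraMap k A (p i) = x i := fun i => by rw [← hx]
  have hy' : ∀ i, algebraMap k A (b i) = y i := fun i => by rw [← hy]
  simp only [map_neg, Fin.sum_univ_three, hx', hy']
  fin_cases i₀
  · simp [crossv, hx', hy'] at h1 ⊢
    refine ⟨h1, fun i => ?_, ?_, ?_⟩
    · fin_cases i
      · simp [hx', hy']
      · convert hn (-y 2) (x 2) using 1; simp [hx', hy']; ring
      · convert hn (y 1) (-x 1) using 1; simp [hx', hy']; ring
    · linear_combination s * h1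
    · linear_combination t * h1
  · simp [crossv, hx', hy'] at h1 ⊢
    refine ⟨h1, fun i => ?_, ?_, ?_⟩
    · fin_cases i
      · convert hn (y 2) (-x 2) using 1; simp [hx', hy']; ring
      · simp [hx', hy']
      · convert hn (-y 0) (x 0) using 1; simp [hx', hy']; ring
    · linear_combination s * h1
    · linear_combination t * h1
  · simp [crossv, hx', hy'] at h1 ⊢
    refine ⟨h1, fun i => ?_, ?_, ?_⟩
    · fin_cases i
      · convert hn (-y 1) (x 1) using 1; simp [hx', hy']; ring
      · convert hn (y 0) (-x 0) using 1; simp [hx', hy']; ring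
      · simp [hx', hy']
    · linear_combination s * h1
    · linear_combination t * h1

/-- Let `ℓ` (dual coordinates `d`, normalized so that `d i₀ = 1` in the
affine chart `u_{i₀} = 1`) be a point of the inflection scheme `{H = K = 0}` through which the
quartic has a singular point.  Let `B` be the localization, at the maximal ideal `P`
corresponding to `[ℓ]`, of the coordinate ring `k[u,v,w]/(H, K, u_{i₀} - 1)` of the chart cut
out by the dehomogenized forms.  If `[ℓ]` is an isolated point of the inflection scheme (so that
`B` is a finite-dimensional `k`-vector space), then the multiplicity of `[ℓ]`, namely
`dim_k B`, is at least `3`. -/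
theorem stmt10 {k : Type*} [Field k] [IsAlgClosed k] (h6 : (6 : k) ≠ 0)
    (q : MvPolynomial (Fin 3) k) (hq0 : q ≠ 0) (hq4 : q.IsHomogeneous 4)
    (H K : MvPolynomial (Fin 3) k)
    (hH : X 0 ^ 4 * H = SG q) (hK : X 0 ^ 6 * K = TG q)
    (d : Fin 3 → k) (i₀ : Fin 3) (hchart : d i₀ = 1)
    (hZH : eval d H = 0) (hZK : eval d K = 0)
    (hsing : ∃ pt : Fin 3 → k, pt ≠ 0 ∧ dot3 d pt = 0 ∧ eval pt q = 0 ∧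
      ∀ i, eval pt (pderiv i q) = 0)
    (J : Ideal (MvPolynomial (Fin 3) k))
    (hJ : J = Ideal.span {H, K, X i₀ - 1})
    (P : Ideal (MvPolynomial (Fin 3) k ⧸ J)) [P.IsPrime]
    (hP : P = Ideal.map (Ideal.Quotient.mk J) (RingHom.ker (eval d)))
    (B : Type*) [CommRing B] [Algebra (MvPolynomial (Fin 3) k ⧸ J) B]
    [IsLocalization.AtPrime B P]
    [Algebra k B] [IsScalarTower k (MvPolynomial (Fin 3) k ⧸ J) B]
    (hiso : Module.Finite k B) :
    3 ≤ Module.rank k B := by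
  obtain ⟨p, hp0, hdp, hpq, hpd⟩ := hsing
  obtain ⟨b, hb⟩ := exists_cross d p hp0 hdp
  obtain ⟨c, hc⟩ := localForm q hq4 p b (Pi.single i₀ (1 : k)) hpq hpd
  have hγ : c 2 2 0 = 0 := inv_base q hq4 H K hH hK p b _ c hc (by rw [hb]; exact hZH)
  by_cases hαβ : c 2 1 1 * c 1 3 0 = 0
  · let s : TrivSqZeroExt k (k × k) := TrivSqZeroExt.inr (1, 0)
    let t : TrivSqZeroExt k (k × k) := TrivSqZeroExt.inr (0, 1)
    have hs : s ^ 2 = 0 := by rw [pow_two]; exact TrivSqZeroExt.inr_mul_inr _ _ _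
    have hst : s * t = 0 := TrivSqZeroExt.inr_mul_inr _ _ _
    have ht2 : t ^ 2 = 0 := by rw [pow_two]; exact TrivSqZeroExt.inr_mul_inr _ _ _
    have ht : t ^ 3 = 0 := by rw [pow_succ, ht2, zero_mul]
    obtain ⟨e1, e2⟩ := inv_local q hq4 H K hH hK p b _ c hc hγ s t hs hst ht
    obtain ⟨f1, f2, f3, f4⟩ := cross_facts d p b i₀ hb hchart s t hs ht _ rfl
    generalize (- ∑ i, C (p i) * X i : MvPolynomial (Fin 3) k) = Ls at f3
    generalize (- ∑ i, C (b i) * X i : MvPolynomial (Fin 3) k) = Lt at f4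
    refine rank_crit H K d i₀ J hJ P hP B _ f2 ?_ e2 f1 ![1, Ls, Lt] ?_
    · rw [e1, ht2, mul_assoc 3, ← map_mul, hαβ]
      simp
    · rw [Fintype.linearIndependent_iff]
      intro g hg
      simp only [Fin.sum_univ_three, Matrix.cons_val_zero, Matrix.cons_val_one,
        Matrix.cons_val_two, Matrix.head_cons, Matrix.tail_cons, Matrix.cons_val, f3, f4,
        map_one] at hg
      have g0 := congrArg TrivSqZeroExt.fst hg
      have g1 := congrArg (fun z => (TrivSqZeroExt.snd z).1) hg
      have g2 := congrArg (fun z => (TrivSqZeroExt.snd z).2) hg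
      simp [s, t] at g0 g1 g2
      intro i
      fin_cases i
      · exact g0
      · exact g1
      · exact g2
  · have h3 : (3 : k) ≠ 0 := by
      intro h
      apply h6
      linear_combination 2 * h
    have hα : c 2 1 1 ≠ 0 := left_ne_zero_of_mul hαβ
    have hβ : c 1 3 0 ≠ 0 := right_ne_zero_of_mul hαβ
    let m : Polynomial k := Polynomial.X ^ 3
    have hm : m ≠ 0 := pow_ne_zero _ Polynomial.X_ne_zero
    let t : AdjoinRoot m := AdjoinRoot.root m
    have ht : t ^ 3 = 0 := by
      have := AdjoinRoot.eval₂_root m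
      simpa [m] using this
    let r : k := c 2 1 1 / (3 * c 1 3 0)
    let s : AdjoinRoot m := algebraMap k _ r * t ^ 2
    have hs : s ^ 2 = 0 := by
      simp only [s]; linear_combination (algebraMap k (AdjoinRoot m) r) ^ 2 * t * ht
    have hst : s * t = 0 := by
      simp only [s]; linear_combination (algebraMap k (AdjoinRoot m) r) * ht
    obtain ⟨e1, e2⟩ := inv_local q hq4 H K hH hK p b _ c hc hγ s t hs hst ht
    obtain ⟨f1, f2, f3, f4⟩ := cross_facts d p b i₀ hb hchart s t hs ht _ rfl
    refine rank_crit H K d i₀ J hJ P hP B _ f2 ?_ e2 f1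
      (fun i => (- ∑ i, C (b i) * X i) ^ (i : ℕ)) ?_
    · rw [e1]
      have hr : c 2 1 1 = 3 * c 1 3 0 * r := by simp only [r]; field_simp
      have hr' := congrArg (algebraMap k (AdjoinRoot m)) hr
      simp only [map_mul, map_ofNat] at hr'
      simp only [s]
      linear_combination (algebraMap k (AdjoinRoot m) (c 2 1 1)) * t ^ 2 * hr'
    · simp only [map_pow, f4]
      have hb := (AdjoinRoot.powerBasis hm).basis.linearIndependent
      rw [PowerBasis.coe_basis] at hb
      have hdim : (AdjoinRoot.powerBasis hm).dim = 3 := by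
        simp [AdjoinRoot.powerBasis_dim, m]
      have := hb.comp (Fin.cast hdim.symm) (Fin.cast_injective _)
      simpa [Function.comp_def] using this
end
end

section
/- Let k be an algebraically closed field of arbitrary characteristic, let C be a smooth plane quartic over k, and let p be a point of P²(k). Then there are at most 8 distinct lines through p that are inflection lines of C, i.e. at most 8 lines through p whose intersection with C contains a point of intersection multiplicity at least 3. -/
open MvPolynomial

noncomputable section

/-- Degree `0,…,4` parts (in `x, y`) of the ternary quartic with coefficients `c`. -/
def g1 {k : Type*} [Field k] (c : Fin 15 → k) (x y : k) : k := c 1 * x + c 2 * y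

def g2 {k : Type*} [Field k] (c : Fin 15 → k) (x y : k) : k :=
  c 3 * x ^ 2 + c 4 * x * y + c 5 * y ^ 2

def g3 {k : Type*} [Field k] (c : Fin 15 → k) (x y : k) : k :=
  c 6 * x ^ 3 + c 7 * x ^ 2 * y + c 8 * x * y ^ 2 + c 9 * y ^ 3

def g4 {k : Type*} [Field k] (c : Fin 15 → k) (x y : k) : k :=
  c 10 * x ^ 4 + c 11 * x ^ 3 * y + c 12 * x ^ 2 * y ^ 2 + c 13 * x * y ^ 3 + c 14 * y ^ 4

def g2x {k : Type*} [Field k] (c : Fin 15 → k) (x y : k) : k :=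
  2 * c 3 * x + c 4 * y

def g3x {k : Type*} [Field k] (c : Fin 15 → k) (x y : k) : k :=
  3 * c 6 * x ^ 2 + 2 * c 7 * x * y + c 8 * y ^ 2

def g4x {k : Type*} [Field k] (c : Fin 15 → k) (x y : k) : k :=
  4 * c 10 * x ^ 3 + 3 * c 11 * x ^ 2 * y + 2 * c 12 * x * y ^ 2 + c 13 * y ^ 3

def g2y {k : Type*} [Field k] (c : Fin 15 → k) (x y : k) : k :=
  c 4 * x + 2 * c 5 * y

def g3y {k : Type*} [Field k] (c : Fin 15 → k) (x y : k) : k :=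
  c 7 * x ^ 2 + 2 * c 8 * x * y + 3 * c 9 * y ^ 2

def g4y {k : Type*} [Field k] (c : Fin 15 → k) (x y : k) : k :=
  c 11 * x ^ 3 + 2 * c 12 * x ^ 2 * y + 3 * c 13 * x * y ^ 2 + 4 * c 14 * y ^ 3

/-- Smoothness of the ternary quartic with coefficients `c`. -/
def SmoothC {k : Type*} [Field k] (c : Fin 15 → k) : Prop :=
  ∀ x y z : k, (x ≠ 0 ∨ y ≠ 0 ∨ z ≠ 0) →
    c 0 * z ^ 4 + g1 c x y * z ^ 3 + g2 c x y * z ^ 2 + g3 c x y * z + g4 c x y = 0 →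
    c 1 * z ^ 3 + g2x c x y * z ^ 2 + g3x c x y * z + g4x c x y = 0 →
    c 2 * z ^ 3 + g2y c x y * z ^ 2 + g3y c x y * z + g4y c x y = 0 →
    4 * c 0 * z ^ 3 + 3 * g1 c x y * z ^ 2 + 2 * g2 c x y * z + g3 c x y = 0 → False

/-- The binary quartic `(f0,…,f4)` has a triple root. -/
def Trip {k : Type*} [Field k] (f0 f1 f2 f3 f4 : k) : Prop :=
  ∃ l1 l2 m1 m2 : k, f0 = l1 ^ 3 * m1 ∧ f1 = 3 * l1 ^ 2 * l2 * m1 + l1 ^ 3 * m2 ∧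
    f2 = 3 * l1 * l2 ^ 2 * m1 + 3 * l1 ^ 2 * l2 * m2 ∧
    f3 = l2 ^ 3 * m1 + 3 * l1 * l2 ^ 2 * m2 ∧ f4 = l2 ^ 3 * m2

def sC0 {k : Type*} [Field k] (c : Fin 15 → k) : k :=
  (12)*c 0*c 14 + (-3)*c 2*c 9 + (1)*c 5*c 5

def sC1 {k : Type*} [Field k] (c : Fin 15 → k) : k :=
  (12)*c 0*c 13 + (-3)*c 1*c 9 + (-3)*c 2*c 8 + (2)*c 4*c 5

def sC2 {k : Type*} [Field k] (c : Fin 15 → k) : k :=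
  (12)*c 0*c 12 + (-3)*c 1*c 8 + (-3)*c 2*c 7 + (2)*c 3*c 5 + (1)*c 4*c 4

def sC3 {k : Type*} [Field k] (c : Fin 15 → k) : k :=
  (12)*c 0*c 11 + (-3)*c 1*c 7 + (-3)*c 2*c 6 + (2)*c 3*c 4

def sC4 {k : Type*} [Field k] (c : Fin 15 → k) : k :=
  (12)*c 0*c 10 + (-3)*c 1*c 6 + (1)*c 3*c 3

def tC0 {k : Type*} [Field k] (c : Fin 15 → k) : k :=
  (72)*c 0*c 5*c 14 + (-27)*c 0*c 9*c 9 + (-27)*c 2*c 2*c 14 + (9)*c 2*c 5*c 9 +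
    (-2)*c 5*c 5*c 5

def tC1 {k : Type*} [Field k] (c : Fin 15 → k) : k :=
  (72)*c 0*c 4*c 14 + (72)*c 0*c 5*c 13 + (-54)*c 0*c 8*c 9 + (-54)*c 1*c 2*c 14 +
    (9)*c 1*c 5*c 9 + (-27)*c 2*c 2*c 13 + (9)*c 2*c 4*c 9 + (9)*c 2*c 5*c 8 + (-6)*c 4*c 5*c 5

def tC2 {k : Type*} [Field k] (c : Fin 15 → k) : k :=
  (72)*c 0*c 3*c 14 + (72)*c 0*c 4*c 13 + (72)*c 0*c 5*c 12 + (-54)*c 0*c 7*c 9 +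
    (-27)*c 0*c 8*c 8 + (-27)*c 1*c 1*c 14 + (-54)*c 1*c 2*c 13 + (9)*c 1*c 4*c 9 +
    (9)*c 1*c 5*c 8 + (-27)*c 2*c 2*c 12 + (9)*c 2*c 3*c 9 + (9)*c 2*c 4*c 8 + (9)*c 2*c 5*c 7 +
    (-6)*c 3*c 5*c 5 + (-6)*c 4*c 4*c 5

def tC3 {k : Type*} [Field k] (c : Fin 15 → k) : k :=
  (72)*c 0*c 3*c 13 + (72)*c 0*c 4*c 12 + (72)*c 0*c 5*c 11 + (-54)*c 0*c 6*c 9 +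
    (-54)*c 0*c 7*c 8 + (-27)*c 1*c 1*c 13 + (-54)*c 1*c 2*c 12 + (9)*c 1*c 3*c 9 +
    (9)*c 1*c 4*c 8 + (9)*c 1*c 5*c 7 + (-27)*c 2*c 2*c 11 + (9)*c 2*c 3*c 8 + (9)*c 2*c 4*c 7 +
    (9)*c 2*c 5*c 6 + (-12)*c 3*c 4*c 5 + (-2)*c 4*c 4*c 4

def tC4 {k : Type*} [Field k] (c : Fin 15 → k) : k :=
  (72)*c 0*c 3*c 12 + (72)*c 0*c 4*c 11 + (72)*c 0*c 5*c 10 + (-54)*c 0*c 6*c 8 +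
    (-27)*c 0*c 7*c 7 + (-27)*c 1*c 1*c 12 + (-54)*c 1*c 2*c 11 + (9)*c 1*c 3*c 8 +
    (9)*c 1*c 4*c 7 + (9)*c 1*c 5*c 6 + (-27)*c 2*c 2*c 10 + (9)*c 2*c 3*c 7 + (9)*c 2*c 4*c 6 +
    (-6)*c 3*c 3*c 5 + (-6)*c 3*c 4*c 4

def tC5 {k : Type*} [Field k] (c : Fin 15 → k) : k :=
  (72)*c 0*c 3*c 11 + (72)*c 0*c 4*c 10 + (-54)*c 0*c 6*c 7 + (-27)*c 1*c 1*c 11 +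
    (-54)*c 1*c 2*c 10 + (9)*c 1*c 3*c 7 + (9)*c 1*c 4*c 6 + (9)*c 2*c 3*c 6 + (-6)*c 3*c 3*c 4

def tC6 {k : Type*} [Field k] (c : Fin 15 → k) : k :=
  (72)*c 0*c 3*c 10 + (-27)*c 0*c 6*c 6 + (-27)*c 1*c 1*c 10 + (9)*c 1*c 3*c 6 +
    (-2)*c 3*c 3*c 3

def uC0 {k : Type*} [Field k] (c : Fin 15 → k) : k :=
  (1)*c 0*c 14 + (-1)*c 2*c 9

def uC1 {k : Type*} [Field k] (c : Fin 15 → k) : k :=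
  (1)*c 0*c 13 + (-1)*c 1*c 9 + (-1)*c 2*c 8

def uC2 {k : Type*} [Field k] (c : Fin 15 → k) : k :=
  (1)*c 0*c 12 + (-1)*c 1*c 8 + (-1)*c 2*c 7

def uC3 {k : Type*} [Field k] (c : Fin 15 → k) : k :=
  (1)*c 0*c 11 + (-1)*c 1*c 7 + (-1)*c 2*c 6

def uC4 {k : Type*} [Field k] (c : Fin 15 → k) : k :=
  (1)*c 0*c 10 + (-1)*c 1*c 6

section core
variable {k : Type*} [Field k]

lemma cancel_k {a b : k} (ha : a ≠ 0) (h : a * b = 0) : b = 0 :=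
  (mul_eq_zero.mp h).resolve_left ha

lemma root1 (a b : k) : ∃ x y : k, (x ≠ 0 ∨ y ≠ 0) ∧ a * x + b * y = 0 := by
  by_cases ha : a = 0
  · exact ⟨1, 0, by simp, by simp [ha]⟩
  · exact ⟨b, -a, by simp [ha], by ring⟩

lemma root3 [IsAlgClosed k] (a b c d : k) : ∃ x y : k, (x ≠ 0 ∨ y ≠ 0) ∧
    a * x ^ 3 + b * x ^ 2 * y + c * x * y ^ 2 + d * y ^ 3 = 0 := by
  by_cases ha : a = 0
  · exact ⟨1, 0, by simp, by simp [ha]⟩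
  · obtain ⟨x, hx⟩ := IsAlgClosed.exists_root
      (Polynomial.C a * Polynomial.X ^ 3 + Polynomial.C b * Polynomial.X ^ 2
        + Polynomial.C c * Polynomial.X + Polynomial.C d)
      (by rw [Polynomial.degree_cubic ha]; decide)
    refine ⟨x, 1, by simp, ?_⟩
    simp [Polynomial.IsRoot] at hx
    linear_combination hx

lemma root2 [IsAlgClosed k] (a b c : k) : ∃ x y : k, (x ≠ 0 ∨ y ≠ 0) ∧
    a * x ^ 2 + b * x * y + c * y ^ 2 = 0 := by
  by_cases ha : a = 0
  · exact ⟨1, 0, by simp, by simp [ha]⟩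
  · obtain ⟨x, hx⟩ := IsAlgClosed.exists_root
      (Polynomial.C a * Polynomial.X ^ 2
        + Polynomial.C b * Polynomial.X + Polynomial.C c)
      (by rw [Polynomial.degree_quadratic ha]; decide)
    refine ⟨x, 1, by simp, ?_⟩
    simp [Polynomial.IsRoot] at hx
    linear_combination hx

lemma S_val (c : Fin 15 → k) (x y : k) :
    12 * c 0 * g4 c x y - 3 * g1 c x y * g3 c x y + g2 c x y ^ 2 =
      sC0 c * y ^ 4 + sC1 c * x * y ^ 3 + sC2 c * x ^ 2 * y ^ 2 + sC3 c * x ^ 3 * y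
        + sC4 c * x ^ 4 := by
  simp only [g1, g2, g3, g4, sC0, sC1, sC2, sC3, sC4]; ring

lemma U_val (c : Fin 15 → k) (x y : k) :
    c 0 * g4 c x y - g1 c x y * g3 c x y =
      uC0 c * y ^ 4 + uC1 c * x * y ^ 3 + uC2 c * x ^ 2 * y ^ 2 + uC3 c * x ^ 3 * y
        + uC4 c * x ^ 4 := by
  simp only [g1, g3, g4, uC0, uC1, uC2, uC3, uC4]; ring

lemma T_val (c : Fin 15 → k) (x y : k) :
    72 * c 0 * g2 c x y * g4 c x y - 27 * c 0 * g3 c x y ^ 2 - 27 * g1 c x y ^ 2 * g4 c x y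
      + 9 * g1 c x y * g2 c x y * g3 c x y - 2 * g2 c x y ^ 3 =
      tC0 c * y ^ 6 + tC1 c * x * y ^ 5 + tC2 c * x ^ 2 * y ^ 4 + tC3 c * x ^ 3 * y ^ 3
        + tC4 c * x ^ 4 * y ^ 2 + tC5 c * x ^ 5 * y + tC6 c * x ^ 6 := by
  simp only [g1, g2, g3, g4, tC0, tC1, tC2, tC3, tC4, tC5, tC6]; ring

lemma S_dx (c : Fin 15 → k) (x y : k) :
    12 * c 0 * g4x c x y - 3 * (c 1 * g3 c x y + g1 c x y * g3x c x y)
      + 2 * g2 c x y * g2x c x y =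
      sC1 c * y ^ 3 + 2 * sC2 c * x * y ^ 2 + 3 * sC3 c * x ^ 2 * y + 4 * sC4 c * x ^ 3 := by
  simp only [g1, g2, g3, g2x, g3x, g4x, sC1, sC2, sC3, sC4]; ring

lemma S_dy (c : Fin 15 → k) (x y : k) :
    12 * c 0 * g4y c x y - 3 * (c 2 * g3 c x y + g1 c x y * g3y c x y)
      + 2 * g2 c x y * g2y c x y =
      4 * sC0 c * y ^ 3 + 3 * sC1 c * x * y ^ 2 + 2 * sC2 c * x ^ 2 * y + sC3 c * x ^ 3 := by
  simp only [g1, g2, g3, g2y, g3y, g4y, sC0, sC1, sC2, sC3]; ring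

lemma U_dx (c : Fin 15 → k) (x y : k) :
    c 0 * g4x c x y - (c 1 * g3 c x y + g1 c x y * g3x c x y) =
      uC1 c * y ^ 3 + 2 * uC2 c * x * y ^ 2 + 3 * uC3 c * x ^ 2 * y + 4 * uC4 c * x ^ 3 := by
  simp only [g1, g3, g3x, g4x, uC1, uC2, uC3, uC4]; ring

lemma U_dy (c : Fin 15 → k) (x y : k) :
    c 0 * g4y c x y - (c 2 * g3 c x y + g1 c x y * g3y c x y) =
      4 * uC0 c * y ^ 3 + 3 * uC1 c * x * y ^ 2 + 2 * uC2 c * x ^ 2 * y + uC3 c * x ^ 3 := by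
  simp only [g1, g3, g3y, g4y, uC0, uC1, uC2, uC3]; ring

lemma T_dx (c : Fin 15 → k) (x y : k) :
    72 * c 0 * (g2x c x y * g4 c x y + g2 c x y * g4x c x y) - 54 * c 0 * g3 c x y * g3x c x y
      - 54 * g1 c x y * c 1 * g4 c x y - 27 * g1 c x y ^ 2 * g4x c x y
      + 9 * (c 1 * g2 c x y * g3 c x y + g1 c x y * g2x c x y * g3 c x y
        + g1 c x y * g2 c x y * g3x c x y) - 6 * g2 c x y ^ 2 * g2x c x y =
      tC1 c * y ^ 5 + 2 * tC2 c * x * y ^ 4 + 3 * tC3 c * x ^ 2 * y ^ 3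
        + 4 * tC4 c * x ^ 3 * y ^ 2 + 5 * tC5 c * x ^ 4 * y + 6 * tC6 c * x ^ 5 := by
  simp only [g1, g2, g3, g4, g2x, g3x, g4x, tC1, tC2, tC3, tC4, tC5, tC6]; ring

lemma T_dy (c : Fin 15 → k) (x y : k) :
    72 * c 0 * (g2y c x y * g4 c x y + g2 c x y * g4y c x y) - 54 * c 0 * g3 c x y * g3y c x y
      - 54 * g1 c x y * c 2 * g4 c x y - 27 * g1 c x y ^ 2 * g4y c x y
      + 9 * (c 2 * g2 c x y * g3 c x y + g1 c x y * g2y c x y * g3 c x y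
        + g1 c x y * g2 c x y * g3y c x y) - 6 * g2 c x y ^ 2 * g2y c x y =
      6 * tC0 c * y ^ 5 + 5 * tC1 c * x * y ^ 4 + 4 * tC2 c * x ^ 2 * y ^ 3
        + 3 * tC3 c * x ^ 3 * y ^ 2 + 2 * tC4 c * x ^ 4 * y + tC5 c * x ^ 5 := by
  simp only [g1, g2, g3, g4, g2y, g3y, g4y, tC0, tC1, tC2, tC3, tC4, tC5]; ring

/-- If `g0 = g1 = 0` then the base point is singular. -/
lemma base_sing (c : Fin 15 → k) (hs : SmoothC c) (h0 : c 0 = 0) (h1 : c 1 = 0) (h2 : c 2 = 0) :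
    False :=
  hs 0 0 1 (by simp) (by simp [h0, g1, g2, g3, g4]) (by simp [h1, g2x, g3x, g4x])
    (by simp [h2, g2y, g3y, g4y]) (by simp [h0, g1, g2, g3])

lemma g1_ne (c : Fin 15 → k) (h : ¬ (c 1 = 0 ∧ c 2 = 0)) : ∃ x y : k, g1 c x y ≠ 0 := by
  by_cases h1 : c 1 = 0
  · exact ⟨0, 1, by simpa [g1] using fun h2 => h ⟨h1, h2⟩⟩
  · exact ⟨1, 0, by simpa [g1] using h1⟩

lemma ne_of_g1 (c : Fin 15 → k) {x y z : k} (h : g1 c x y ≠ 0) : x ≠ 0 ∨ y ≠ 0 ∨ z ≠ 0 := by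
  by_contra! hh
  exact h (by simp [g1, hh.1, hh.2.1])

/-- Characteristic different from `3`. -/
lemma case_ne3 [IsAlgClosed k] (c : Fin 15 → k) (hs : SmoothC c) (h3 : (3 : k) ≠ 0)
    (hS : ∀ x y, 12 * c 0 * g4 c x y - 3 * g1 c x y * g3 c x y + g2 c x y ^ 2 = 0)
    (hSx : ∀ x y, 12 * c 0 * g4x c x y - 3 * (c 1 * g3 c x y + g1 c x y * g3x c x y)
      + 2 * g2 c x y * g2x c x y = 0)
    (hSy : ∀ x y, 12 * c 0 * g4y c x y - 3 * (c 2 * g3 c x y + g1 c x y * g3y c x y)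
      + 2 * g2 c x y * g2y c x y = 0)
    (hT : ∀ x y, 72 * c 0 * g2 c x y * g4 c x y - 27 * c 0 * g3 c x y ^ 2
      - 27 * g1 c x y ^ 2 * g4 c x y
      + 9 * g1 c x y * g2 c x y * g3 c x y - 2 * g2 c x y ^ 3 = 0)
    (hTx : ∀ x y, 72 * c 0 * (g2x c x y * g4 c x y + g2 c x y * g4x c x y)
      - 54 * c 0 * g3 c x y * g3x c x y
      - 54 * g1 c x y * c 1 * g4 c x y - 27 * g1 c x y ^ 2 * g4x c x y
      + 9 * (c 1 * g2 c x y * g3 c x y + g1 c x y * g2x c x y * g3 c x y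
        + g1 c x y * g2 c x y * g3x c x y) - 6 * g2 c x y ^ 2 * g2x c x y = 0)
    (hTy : ∀ x y, 72 * c 0 * (g2y c x y * g4 c x y + g2 c x y * g4y c x y)
      - 54 * c 0 * g3 c x y * g3y c x y
      - 54 * g1 c x y * c 2 * g4 c x y - 27 * g1 c x y ^ 2 * g4y c x y
      + 9 * (c 2 * g2 c x y * g3 c x y + g1 c x y * g2y c x y * g3 c x y
        + g1 c x y * g2 c x y * g3y c x y) - 6 * g2 c x y ^ 2 * g2y c x y = 0) : False := by
  by_cases h0 : c 0 = 0
  · -- the base point lies on the curve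
    by_cases h12 : c 1 = 0 ∧ c 2 = 0
    · exact base_sing c hs h0 h12.1 h12.2
    obtain ⟨x, y, hg⟩ := g1_ne c h12
    have eS := hS x y
    have eSx := hSx x y
    have eSy := hSy x y
    have eT := hT x y
    have eTx := hTx x y
    have eTy := hTy x y
    rw [h0] at eS eSx eSy eT eTx eTy
    obtain ⟨z, hz⟩ : ∃ z, g2 c x y = -3 * g1 c x y * z := ⟨-g2 c x y / (3 * g1 c x y), by field_simp⟩
    have e3 : g3 c x y = 3 * g1 c x y * z ^ 2 := by
      have : (3 * g1 c x y) * (g3 c x y - 3 * g1 c x y * z ^ 2) = 0 := by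
        rw [hz] at eS; linear_combination -eS
      have := (mul_eq_zero.mp this).resolve_left (mul_ne_zero h3 hg)
      linear_combination this
    have e4 : g4 c x y = - g1 c x y * z ^ 3 := by
      have : (27 * g1 c x y ^ 2) * (g4 c x y + g1 c x y * z ^ 3) = 0 := by
        rw [hz, e3] at eT; linear_combination -eT
      have := (mul_eq_zero.mp this).resolve_left
        (mul_ne_zero (by rw [show (27 : k) = 3 ^ 3 by norm_num]; positivity) (pow_ne_zero _ hg))
      linear_combination this
    have dd : ∀ a b d e : k,
        12 * 0 * e - 3 * (a * g3 c x y + g1 c x y * d) + 2 * g2 c x y * b = 0 →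
        72 * 0 * (b * g4 c x y + g2 c x y * e) - 54 * 0 * g3 c x y * d
          - 54 * g1 c x y * a * g4 c x y - 27 * g1 c x y ^ 2 * e
          + 9 * (a * g2 c x y * g3 c x y + g1 c x y * b * g3 c x y
          + g1 c x y * g2 c x y * d) - 6 * g2 c x y ^ 2 * b = 0 →
        a * z ^ 3 + b * z ^ 2 + d * z + e = 0 := by
      intro a b d e h h'
      rw [hz, e3] at h
      rw [hz, e3, e4] at h'
      have hd : (3 * g1 c x y) * (d + 3 * z ^ 2 * a + 2 * z * b) = 0 := by
        linear_combination -h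
      have hd := (mul_eq_zero.mp hd).resolve_left (mul_ne_zero h3 hg)
      have hd' : d = - 3 * z ^ 2 * a - 2 * z * b := by linear_combination hd
      subst hd'
      have he : (27 * g1 c x y ^ 2) * (e - 2 * z ^ 3 * a - z ^ 2 * b) = 0 := by
        linear_combination -h'
      have he := (mul_eq_zero.mp he).resolve_left
        (mul_ne_zero (by rw [show (27 : k) = 3 ^ 3 by norm_num]; exact pow_ne_zero _ h3)
          (pow_ne_zero _ hg))
      linear_combination he
    refine hs x y z (ne_of_g1 c hg) ?_ (dd _ _ _ _ eSx eTx) (dd _ _ _ _ eSy eTy) ?_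
    · rw [h0, hz, e3, e4]; ring
    · rw [h0, hz, e3]; ring
  by_cases h2 : (2 : k) = 0
  · -- characteristic two
    by_cases h12 : c 1 = 0 ∧ c 2 = 0
    · have hg1 : ∀ x y, g1 c x y = 0 := fun x y => by simp [g1, h12.1, h12.2]
      have hg2 : ∀ x y, g2 c x y = 0 := fun x y => by
        have := hS x y
        rw [hg1] at this
        have : g2 c x y ^ 2 = 0 := by linear_combination this - 6 * c 0 * g4 c x y * h2
        exact pow_eq_zero_iff (two_ne_zero) |>.mp this
      have hg3 : ∀ x y, g3 c x y = 0 := fun x y => by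
        have := hT x y
        rw [hg1, hg2] at this
        have : c 0 * g3 c x y ^ 2 = 0 := by
          linear_combination this + 14 * c 0 * g3 c x y ^ 2 * h2
        exact pow_eq_zero_iff (two_ne_zero) |>.mp ((mul_eq_zero.mp this).resolve_left h0)
      have a3 : c 3 = 0 := by simpa [g2] using hg2 1 0
      have a5 : c 5 = 0 := by simpa [g2] using hg2 0 1
      have a4 : c 4 = 0 := by simpa [g2, a3, a5] using hg2 1 1
      have hSx' : ∀ x y, g3x c x y = 0 ∧ g3y c x y = 0 := by
        have a6 : c 6 = 0 := by simpa [g3] using hg3 1 0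
        have a9 : c 9 = 0 := by simpa [g3] using hg3 0 1
        have a78 : c 7 + c 8 = 0 := by simpa [g3, a6, a9] using hg3 1 1
        obtain ⟨t, ht⟩ : ∃ t : k, t ^ 2 + t + 1 = 0 := by
          obtain ⟨x, hx⟩ := IsAlgClosed.exists_root
            (Polynomial.C 1 * Polynomial.X ^ 2
              + Polynomial.C 1 * Polynomial.X + Polynomial.C (1 : k))
            (by rw [Polynomial.degree_quadratic one_ne_zero]; decide)
          refine ⟨x, ?_⟩
          simp [Polynomial.IsRoot] at hx
          linear_combination hx
        have := hg3 t 1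
        simp only [g3, a6, a9] at this
        have a7 : c 7 = 0 := by
          have h : c 7 = 0 := by
            linear_combination -this + c 7 * ht + t * a78 - c 7 * t * h2
          exact h
        have a8 : c 8 = 0 := by simpa [a7] using a78
        intro x y
        simp [g3x, g3y, a6, a7, a8, a9]
      obtain ⟨x, y, hxy, hr⟩ := root2 (c 11) 0 (c 13)
      obtain ⟨z, hz⟩ := IsAlgClosed.exists_pow_nat_eq (-g4 c x y / c 0) (n := 4) (by norm_num)
      refine hs x y z (by tauto) ?_ ?_ ?_ ?_
      · rw [hg1, hg2, hg3, hz]; field_simp; ring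
      · rw [(hSx' x y).1, h12.1]; simp only [g2x, g4x, a3, a4]
        linear_combination y * hr + (2 * c 10 * x ^ 3 + c 11 * x ^ 2 * y + c 12 * x * y ^ 2) * h2
      · rw [(hSx' x y).2, h12.2]; simp only [g2y, g4y, a5, a4]
        linear_combination x * hr + (2 * c 14 * y ^ 3 + c 12 * x ^ 2 * y + c 13 * x * y ^ 2) * h2
      · rw [hg1, hg2, hg3]; linear_combination 2 * c 0 * z ^ 3 * h2
    · obtain ⟨x, y, hg⟩ := g1_ne c h12
      have eS := hS x y
      have eSx := hSx x y
      have eSy := hSy x y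
      have eT := hT x y
      have eTx := hTx x y
      have eTy := hTy x y
      obtain ⟨z, hz⟩ : ∃ z, g2 c x y = g1 c x y * z := ⟨g2 c x y / g1 c x y, by field_simp⟩
      have e3 : g3 c x y = g1 c x y * z ^ 2 := by
        have : (g1 c x y) * (g3 c x y - g1 c x y * z ^ 2) = 0 := by
          rw [hz] at eS
          linear_combination eS + (2 * g1 c x y * g3 c x y - 6 * c 0 * g4 c x y
            - g1 c x y ^ 2 * z ^ 2) * h2
        have := (mul_eq_zero.mp this).resolve_left hg
        linear_combination this
      have e4 : g4 c x y = c 0 * z ^ 4 + g1 c x y * z ^ 3 := by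
        have : (g1 c x y ^ 2) * (g4 c x y - c 0 * z ^ 4 - g1 c x y * z ^ 3) = 0 := by
          rw [hz, e3] at eT
          linear_combination eT + (14 * g1 c x y ^ 2 * g4 c x y - 36 * c 0 * g1 c x y * z * g4 c x y
            + 13 * c 0 * g1 c x y ^ 2 * z ^ 4 - 4 * g1 c x y ^ 3 * z ^ 3) * h2
        have := (mul_eq_zero.mp this).resolve_left (pow_ne_zero _ hg)
        linear_combination this
      have dd : ∀ a b d e : k,
          12 * c 0 * e - 3 * (a * g3 c x y + g1 c x y * d) + 2 * g2 c x y * b = 0 →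
          72 * c 0 * (b * g4 c x y + g2 c x y * e) - 54 * c 0 * g3 c x y * d
            - 54 * g1 c x y * a * g4 c x y - 27 * g1 c x y ^ 2 * e
            + 9 * (a * g2 c x y * g3 c x y + g1 c x y * b * g3 c x y
            + g1 c x y * g2 c x y * d) - 6 * g2 c x y ^ 2 * b = 0 →
          a * z ^ 3 + b * z ^ 2 + d * z + e = 0 := by
        intro a b d e h h'
        have hd : (g1 c x y) * (d + z ^ 2 * a) = 0 := by
          linear_combination h - a * e3 + (2 * (a * g3 c x y + g1 c x y * d)
            - 6 * c 0 * e - g2 c x y * b) * h2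
        have hd := (mul_eq_zero.mp hd).resolve_left hg
        have hd' : d = z ^ 2 * a := by linear_combination hd - z ^ 2 * a * h2
        rw [hz, e3] at h'
        subst hd'
        have he : (g1 c x y ^ 2) * (e + z ^ 2 * b) = 0 := by
          linear_combination h' + (- 36 * c 0 * (b * g4 c x y + g1 c x y * z * e)
            + 27 * c 0 * (g1 c x y * z ^ 2) * (z ^ 2 * a) + 27 * g1 c x y * a * g4 c x y
            + 14 * g1 c x y ^ 2 * e - 9 * a * g1 c x y ^ 2 * z ^ 3
            - 4 * g1 c x y ^ 2 * z ^ 2 * b + 3 * g1 c x y ^ 2 * z ^ 2 * b) * h2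
        have he := (mul_eq_zero.mp he).resolve_left (pow_ne_zero _ hg)
        linear_combination he + z ^ 3 * a * h2
      refine hs x y z (ne_of_g1 c hg) ?_ (dd _ _ _ _ eSx eTx) (dd _ _ _ _ eSy eTy) ?_
      · rw [hz, e3, e4]; linear_combination (c 0 * z ^ 4 + 2 * g1 c x y * z ^ 3) * h2
      · rw [hz, e3]
        linear_combination (2 * c 0 * z ^ 3 + 3 * g1 c x y * z ^ 2) * h2
  · -- characteristic different from two and three
    obtain ⟨x, y, hxy, hr⟩ := root2 (3 * c 1 ^ 2 - 8 * c 0 * c 3)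
      (6 * c 1 * c 2 - 8 * c 0 * c 4) (3 * c 2 ^ 2 - 8 * c 0 * c 5)
    have hH : 3 * g1 c x y ^ 2 - 8 * c 0 * g2 c x y = 0 := by
      simp only [g1, g2]; linear_combination hr
    have h4 : (4 : k) ≠ 0 := by
      rw [show (4 : k) = 2 ^ 2 by norm_num]; exact pow_ne_zero _ h2
    have h8 : (8 : k) ≠ 0 := by
      rw [show (8 : k) = 2 ^ 3 by norm_num]; exact pow_ne_zero _ h2
    have h12 : (12 : k) ≠ 0 := by
      rw [show (12 : k) = 3 * 4 by norm_num]; exact mul_ne_zero h3 h4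
    obtain ⟨z, e1⟩ : ∃ z, g1 c x y = - 4 * c 0 * z := ⟨-g1 c x y / (4 * c 0), by field_simp⟩
    have e2 : g2 c x y = 6 * c 0 * z ^ 2 := by
      have : (8 * c 0) * (g2 c x y - 6 * c 0 * z ^ 2) = 0 := by
        rw [e1] at hH; linear_combination -hH
      have := (mul_eq_zero.mp this).resolve_left (mul_ne_zero h8 h0)
      linear_combination this
    have e4 : g4 c x y = - z * g3 c x y - 3 * c 0 * z ^ 4 := by
      have := hS x y
      rw [e1, e2] at this
      have : (12 * c 0) * (g4 c x y + z * g3 c x y + 3 * c 0 * z ^ 4) = 0 := by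
        linear_combination this
      have := (mul_eq_zero.mp this).resolve_left (mul_ne_zero h12 h0)
      linear_combination this
    have e3 : g3 c x y = - 4 * c 0 * z ^ 3 := by
      have := hT x y
      rw [e1, e2, e4] at this
      have : (27 * c 0) * (g3 c x y + 4 * c 0 * z ^ 3) ^ 2 = 0 := by
        linear_combination -this
      have := (mul_eq_zero.mp this).resolve_left (mul_ne_zero
        (by rw [show (27 : k) = 3 ^ 3 by norm_num]; exact pow_ne_zero _ h3) h0)
      have := pow_eq_zero_iff (two_ne_zero) |>.mp this
      linear_combination this
    have dd : ∀ a b d e : k,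
        12 * c 0 * e - 3 * (a * g3 c x y + g1 c x y * d) + 2 * g2 c x y * b = 0 →
        a * z ^ 3 + b * z ^ 2 + d * z + e = 0 := by
      intro a b d e h
      rw [e1, e2, e3] at h
      have : (12 * c 0) * (a * z ^ 3 + b * z ^ 2 + d * z + e) = 0 := by linear_combination h
      exact (mul_eq_zero.mp this).resolve_left (mul_ne_zero h12 h0)
    refine hs x y z (by tauto) ?_ (dd _ _ _ _ (hSx x y)) (dd _ _ _ _ (hSy x y)) ?_
    · rw [e4, e1, e2, e3]; ring
    · rw [e1, e2, e3]; ring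

/-- Characteristic `3`. -/
lemma case_3 [IsAlgClosed k] (c : Fin 15 → k) (hs : SmoothC c) (h3 : (3 : k) = 0)
    (a3 : c 3 = 0) (a4 : c 4 = 0) (a5 : c 5 = 0)
    (u0 : uC0 c = 0) (u1 : uC1 c = 0) (u2 : uC2 c = 0) (u3 : uC3 c = 0) (u4 : uC4 c = 0) :
    False := by
  have hU : ∀ x y, c 0 * g4 c x y - g1 c x y * g3 c x y = 0 := fun x y => by
    rw [U_val, u0, u1, u2, u3, u4]; ring
  have hUx : ∀ x y, c 0 * g4x c x y - (c 1 * g3 c x y + g1 c x y * g3x c x y) = 0 :=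
    fun x y => by rw [U_dx, u1, u2, u3, u4]; ring
  have hUy : ∀ x y, c 0 * g4y c x y - (c 2 * g3 c x y + g1 c x y * g3y c x y) = 0 :=
    fun x y => by rw [U_dy, u0, u1, u2, u3]; ring
  have hg2 : ∀ x y, g2 c x y = 0 := fun x y => by simp [g2, a3, a4, a5]
  have hg2x : ∀ x y, g2x c x y = 0 := fun x y => by simp [g2x, a3, a4]
  have hg2y : ∀ x y, g2y c x y = 0 := fun x y => by simp [g2y, a5, a4]
  by_cases h0 : c 0 = 0
  · by_cases h12 : c 1 = 0 ∧ c 2 = 0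
    · exact base_sing c hs h0 h12.1 h12.2
    have a69 : c 6 = 0 ∧ c 7 = 0 ∧ c 8 = 0 ∧ c 9 = 0 := by
      simp only [uC0, uC1, uC2, uC3, uC4, h0] at u0 u1 u2 u3 u4
      by_cases h1 : c 1 = 0
      · have h2 : c 2 ≠ 0 := fun h => h12 ⟨h1, h⟩
        refine ⟨?_, ?_, ?_, ?_⟩ <;> refine cancel_k h2 ?_
        · linear_combination -u3 - c 7 * h1
        · linear_combination -u2 - c 8 * h1
        · linear_combination -u1 - c 9 * h1
        · linear_combination -u0
      · have b6 : c 6 = 0 := by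
          refine cancel_k h1 ?_
          linear_combination -u4
        have b7 : c 7 = 0 := by
          refine cancel_k h1 ?_
          linear_combination -u3 - c 2 * b6
        have b8 : c 8 = 0 := by
          refine cancel_k h1 ?_
          linear_combination -u2 - c 2 * b7
        have b9 : c 9 = 0 := by
          refine cancel_k h1 ?_
          linear_combination -u1 - c 2 * b8
        exact ⟨b6, b7, b8, b9⟩
    obtain ⟨a6, a7, a8, a9⟩ := a69
    have hg3 : ∀ x y, g3 c x y = 0 := fun x y => by simp [g3, a6, a7, a8, a9]
    have hg3x : ∀ x y, g3x c x y = 0 := fun x y => by simp [g3x, a6, a7, a8]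
    have hg3y : ∀ x y, g3y c x y = 0 := fun x y => by simp [g3y, a7, a8, a9]
    obtain ⟨x, y, hxy, hr⟩ := root3 (c 2 * (4 * c 10) - c 1 * c 11)
      (c 2 * (3 * c 11) - c 1 * (2 * c 12)) (c 2 * (2 * c 12) - c 1 * (3 * c 13))
      (c 2 * c 13 - c 1 * (4 * c 14))
    have hr' : c 2 * g4x c x y - c 1 * g4y c x y = 0 := by
      simp only [g4x, g4y]; linear_combination hr
    obtain ⟨z, hzx, hzy⟩ : ∃ z, c 1 * z ^ 3 + g4x c x y = 0 ∧ c 2 * z ^ 3 + g4y c x y = 0 := by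
      by_cases h1 : c 1 = 0
      · have h2 : c 2 ≠ 0 := fun h => h12 ⟨h1, h⟩
        obtain ⟨z, hz⟩ := IsAlgClosed.exists_pow_nat_eq (-g4y c x y / c 2) (n := 3) (by norm_num)
        refine ⟨z, ?_, by rw [hz]; field_simp; ring⟩
        rw [h1] at hr' ⊢
        refine cancel_k h2 ?_
        linear_combination hr'
      · obtain ⟨z, hz⟩ := IsAlgClosed.exists_pow_nat_eq (-g4x c x y / c 1) (n := 3) (by norm_num)
        have hz1 : c 1 * z ^ 3 + g4x c x y = 0 := by rw [hz]; field_simp; ring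
        refine ⟨z, hz1, ?_⟩
        refine cancel_k h1 ?_
        linear_combination c 2 * hz1 - hr'
    refine hs x y z (by tauto) ?_ ?_ ?_ ?_
    · rw [hg2, hg3, h0]
      have : x * g4x c x y + y * g4y c x y = 4 * g4 c x y := by
        simp only [g4, g4x, g4y]; ring
      have e : g1 c x y = c 1 * x + c 2 * y := rfl
      linear_combination x * hzx + y * hzy - this + z ^ 3 * e - g4 c x y * h3
    · rw [hg2x, hg3x]; linear_combination hzx
    · rw [hg2y, hg3y]; linear_combination hzy
    · rw [hg2, hg3, h0]; linear_combination g1 c x y * z ^ 2 * h3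
  · obtain ⟨x, y, hxy, hr⟩ := root3 (c 0 ^ 2 * c 6 - c 1 ^ 3)
      (c 0 ^ 2 * c 7 - 3 * c 1 ^ 2 * c 2) (c 0 ^ 2 * c 8 - 3 * c 1 * c 2 ^ 2)
      (c 0 ^ 2 * c 9 - c 2 ^ 3)
    have hr' : c 0 ^ 2 * g3 c x y - g1 c x y ^ 3 = 0 := by
      simp only [g3, g1]; linear_combination hr
    obtain ⟨z, e1⟩ : ∃ z, g1 c x y = - c 0 * z := ⟨-g1 c x y / c 0, by field_simp⟩
    have e3 : g3 c x y = - c 0 * z ^ 3 := by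
      have : c 0 ^ 2 * (g3 c x y + c 0 * z ^ 3) = 0 := by
        rw [e1] at hr'; linear_combination hr'
      have := (mul_eq_zero.mp this).resolve_left (pow_ne_zero _ h0)
      linear_combination this
    refine hs x y z (by tauto) ?_ ?_ ?_ ?_
    · refine cancel_k h0 ?_
      have := hU x y
      rw [e1, e3] at this
      rw [hg2, e1, e3]
      linear_combination this
    · refine cancel_k h0 ?_
      have := hUx x y
      rw [e1, e3] at this
      rw [hg2x]
      linear_combination this
    · refine cancel_k h0 ?_
      have := hUy x y
      rw [e1, e3] at this
      rw [hg2y]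
      linear_combination this
    · rw [hg2, e1, e3]; linear_combination -c 0 * z ^ 2 * z * 0 * h3

end core


section geom
variable {k : Type*} [Field k]

lemma mkP (s : Fin 7 → k) (i : Fin 7) (hs : s i ≠ 0) : ∃ P : Polynomial k, P ≠ 0 ∧
    P.natDegree ≤ 6 ∧ ∀ t, P.eval t = s 0 + s 1 * t + s 2 * t ^ 2 + s 3 * t ^ 3 + s 4 * t ^ 4
      + s 5 * t ^ 5 + s 6 * t ^ 6 := by
  refine ⟨∑ j : Fin 7, Polynomial.C (s j) * Polynomial.X ^ (j : ℕ), ?_, ?_, ?_⟩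
  · intro h
    have := congrArg (fun P => Polynomial.coeff P (i : ℕ)) h
    simp only [Polynomial.finsetSum_coeff, Polynomial.coeff_C_mul, Polynomial.coeff_X_pow,
      Polynomial.coeff_zero] at this
    rw [Finset.sum_eq_single i] at this
    · simp at this; exact hs this
    · intro b _ hb
      have : ¬ ((i : ℕ) = (b : ℕ)) := fun h => hb (Fin.ext h.symm)
      simp [this]
    · simp
  · refine Polynomial.natDegree_sum_le_of_forall_le _ _ fun j _ => ?_
    refine (Polynomial.natDegree_C_mul_X_pow_le _ _).trans ?_
    omega
  · intro t
    simp [Fin.sum_univ_succ, Fin.succ]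
    ring

lemma core [IsAlgClosed k] (c : Fin 15 → k) (hs : SmoothC c) : ∃ P : Polynomial k, P ≠ 0 ∧
    P.natDegree ≤ 6 ∧ ∀ t, Trip (c 0) (g1 c t 1) (g2 c t 1) (g3 c t 1) (g4 c t 1) →
      P.eval t = 0 := by
  by_cases h3 : (3 : k) = 0
  · by_cases h345 : c 3 = 0 ∧ c 4 = 0 ∧ c 5 = 0
    · by_cases hu : ∃ i, ![uC0 c, uC1 c, uC2 c, uC3 c, uC4 c, 0, 0] i ≠ 0
      · obtain ⟨i, hi⟩ := hu
        obtain ⟨P, hP, hd, he⟩ := mkP _ i hi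
        refine ⟨P, hP, hd, fun t ht => ?_⟩
        have hv := U_val c t 1
        rw [he]
        obtain ⟨l1, l2, m1, m2, e0, e1, e2, e3, e4⟩ := ht
        rw [e1, e3, e4, e0] at hv
        simp
        linear_combination -hv - h3 * (l1 ^ 2 * l2 * m1 * (l2 ^ 3 * m1 + 3 * l1 * l2 ^ 2 * m2)
          + l1 ^ 3 * m2 * l1 * l2 ^ 2 * m2)
      · push Not at hu
        exact (case_3 c hs h3 h345.1 h345.2.1 h345.2.2 (hu 0) (hu 1) (hu 2) (hu 3) (hu 4)).elim
    · have : ∃ i, ![c 5, c 4, c 3, 0, 0, 0, 0] i ≠ 0 := by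
        by_contra! h
        exact h345 ⟨h 2, h 1, h 0⟩
      obtain ⟨i, hi⟩ := this
      obtain ⟨P, hP, hd, he⟩ := mkP _ i hi
      refine ⟨P, hP, hd, fun t ht => ?_⟩
      rw [he]
      obtain ⟨l1, l2, m1, m2, e0, e1, e2, e3, e4⟩ := ht
      simp [g2] at e2 ⊢
      linear_combination e2 + h3 * (l1 * l2 ^ 2 * m1 + l1 ^ 2 * l2 * m2)
  · by_cases hS : ∃ i, ![sC0 c, sC1 c, sC2 c, sC3 c, sC4 c, 0, 0] i ≠ 0
    · obtain ⟨i, hi⟩ := hS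
      obtain ⟨P, hP, hd, he⟩ := mkP _ i hi
      refine ⟨P, hP, hd, fun t ht => ?_⟩
      have hv := S_val c t 1
      rw [he]
      obtain ⟨l1, l2, m1, m2, e0, e1, e2, e3, e4⟩ := ht
      rw [e1, e3, e4, e0, e2] at hv
      simp
      linear_combination -hv
    by_cases hT : ∃ i, ![tC0 c, tC1 c, tC2 c, tC3 c, tC4 c, tC5 c, tC6 c] i ≠ 0
    · obtain ⟨i, hi⟩ := hT
      obtain ⟨P, hP, hd, he⟩ := mkP _ i hi
      refine ⟨P, hP, hd, fun t ht => ?_⟩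
      have hv := T_val c t 1
      rw [he]
      obtain ⟨l1, l2, m1, m2, e0, e1, e2, e3, e4⟩ := ht
      rw [e1, e3, e4, e0, e2] at hv
      simp
      linear_combination -hv
    push Not at hS hT
    have s0 : sC0 c = 0 := hS 0
    have s1 : sC1 c = 0 := hS 1
    have s2 : sC2 c = 0 := hS 2
    have s3 : sC3 c = 0 := hS 3
    have s4 : sC4 c = 0 := hS 4
    have t0 : tC0 c = 0 := hT 0
    have t1 : tC1 c = 0 := hT 1
    have t2 : tC2 c = 0 := hT 2
    have t3 : tC3 c = 0 := hT 3
    have t4 : tC4 c = 0 := hT 4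
    have t5 : tC5 c = 0 := hT 5
    have t6 : tC6 c = 0 := hT 6
    exfalso
    refine case_ne3 c hs h3 ?_ ?_ ?_ ?_ ?_ ?_ <;> intro x y
    · rw [S_val]; simp only [s0, s1, s2, s3, s4]; ring
    · rw [S_dx]; simp only [s1, s2, s3, s4]; ring
    · rw [S_dy]; simp only [s0, s1, s2, s3]; ring
    · rw [T_val]; simp only [t0, t1, t2, t3, t4, t5, t6]; ring
    · rw [T_dx]; simp only [t1, t2, t3, t4, t5, t6]; ring
    · rw [T_dy]; simp only [t0, t1, t2, t3, t4, t5]; ring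

/-- The ternary quartic with coefficients `c`. -/
def quart (c : Fin 15 → k) : MvPolynomial (Fin 3) k :=
  C (c 0) * X 2 ^ 4 + (C (c 1) * X 0 + C (c 2) * X 1) * X 2 ^ 3
    + (C (c 3) * X 0 ^ 2 + C (c 4) * X 0 * X 1 + C (c 5) * X 1 ^ 2) * X 2 ^ 2
    + (C (c 6) * X 0 ^ 3 + C (c 7) * X 0 ^ 2 * X 1 + C (c 8) * X 0 * X 1 ^ 2
      + C (c 9) * X 1 ^ 3) * X 2
    + (C (c 10) * X 0 ^ 4 + C (c 11) * X 0 ^ 3 * X 1 + C (c 12) * X 0 ^ 2 * X 1 ^ 2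
      + C (c 13) * X 0 * X 1 ^ 3 + C (c 14) * X 1 ^ 4)

lemma quart_add (c d : Fin 15 → k) : quart (c + d) = quart c + quart d := by
  simp only [quart, Pi.add_apply, map_add]; ring

lemma monomial3 (m : Fin 3 →₀ ℕ) (a : k) :
    monomial m a = C a * (X 0 ^ m 0 * X 1 ^ m 1 * X 2 ^ m 2) := by
  rw [monomial_eq, Finsupp.prod_fintype _ _ (by simp), Fin.prod_univ_three]

lemma exists_quart_mon (a : k) (e f g : ℕ) (h : e + f + g = 4) :
    ∃ c : Fin 15 → k, C a * (X 0 ^ e * X 1 ^ f * X 2 ^ g) = quart c := by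
  have key : ∀ i : Fin 15, quart (Pi.single i a) = C a * quart (Pi.single i 1) := by
    intro i
    have : ∀ j, (Pi.single i a : Fin 15 → k) j = a * (Pi.single i 1 : Fin 15 → k) j := by
      intro j
      by_cases hj : j = i
      · subst hj; simp
      · simp [hj]
    simp only [quart, this, map_mul]; ring
  have he : e ≤ 4 := by omega
  have hf : f ≤ 4 := by omega
  obtain rfl : g = 4 - e - f := by omega
  have : ∃ i : Fin 15, quart (Pi.single i (1 : k)) = (X 0 ^ e * X 1 ^ f * X 2 ^ (4 - e - f)) := by
    interval_cases e <;> interval_cases f <;> first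
      | omega
      | (refine ⟨0, ?_⟩; simp [quart]; done)
      | (refine ⟨1, ?_⟩; simp [quart]; done)
      | (refine ⟨2, ?_⟩; simp [quart]; done)
      | (refine ⟨3, ?_⟩; simp [quart]; done)
      | (refine ⟨4, ?_⟩; simp [quart]; done)
      | (refine ⟨5, ?_⟩; simp [quart]; done)
      | (refine ⟨6, ?_⟩; simp [quart]; done)
      | (refine ⟨7, ?_⟩; simp [quart]; done)
      | (refine ⟨8, ?_⟩; simp [quart]; done)
      | (refine ⟨9, ?_⟩; simp [quart]; done)
      | (refine ⟨10, ?_⟩; simp [quart]; done)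
      | (refine ⟨11, ?_⟩; simp [quart]; done)
      | (refine ⟨12, ?_⟩; simp [quart]; done)
      | (refine ⟨13, ?_⟩; simp [quart]; done)
      | (refine ⟨14, ?_⟩; simp [quart]; done)
  obtain ⟨i, hi⟩ := this
  exact ⟨Pi.single i a, by rw [key, hi]⟩

lemma exists_quart (q : MvPolynomial (Fin 3) k) (hq : q.IsHomogeneous 4) :
    ∃ c, q = quart c := by
  rw [q.as_sum]
  refine Finset.sum_induction _ (fun r => ∃ c, r = quart c) ?_ ?_ ?_
  · rintro _ _ ⟨c, rfl⟩ ⟨d, rfl⟩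
    exact ⟨c + d, (quart_add c d).symm⟩
  · exact ⟨0, by simp [quart]⟩
  · intro m hm
    rw [monomial3]
    apply exists_quart_mon
    have := hq (mem_support_iff.mp hm)
    rw [Finsupp.weight_apply, Finsupp.sum_fintype _ _ (by simp), Fin.sum_univ_three] at this
    simpa using this

lemma smooth_quart (c : Fin 15 → k)
    (hsm : ∀ pt : Fin 3 → k, pt ≠ 0 → eval pt (quart c) = 0 →
      ∃ i, eval pt (pderiv i (quart c)) ≠ 0) : SmoothC c := by
  intro x y z hne h hx hy hz
  obtain ⟨i, hi⟩ := hsm ![x, y, z] (by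
    intro h0
    have a0 := congrFun h0 0
    have a1 := congrFun h0 1
    have a2 := congrFun h0 2
    simp at a0 a1 a2
    tauto) (by
    simp only [quart, map_add, map_mul, map_pow, eval_C, eval_X]
    simp [g1, g2, g3, g4] at h ⊢
    linear_combination h)
  apply hi
  fin_cases i
  · simp [quart, pderiv_X]
    simp [g2x, g3x, g4x] at hx
    linear_combination hx
  · simp [quart, pderiv_X]
    simp [g2y, g3y, g4y] at hy
    linear_combination hy
  · simp [quart, pderiv_X]
    simp [g1, g2, g3] at hz
    linear_combination hz

lemma eval_substM (M : Matrix (Fin 3) (Fin 3) k) (q : MvPolynomial (Fin 3) k) (v : Fin 3 → k) :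
    eval v (substM M q) = eval (M.mulVec v) q := by
  unfold substM
  induction q using MvPolynomial.induction_on with
  | C a => simp
  | add p q hp hq => simp only [map_add, hp, hq]
  | mul_X p i hp =>
    simp only [map_mul, hp, aeval_X, eval_X]
    congr 1
    simp [Matrix.mulVec, dotProduct]

lemma pderiv_substM (M : Matrix (Fin 3) (Fin 3) k) (q : MvPolynomial (Fin 3) k) (v : Fin 3 → k)
    (i : Fin 3) :
    eval v (pderiv i (substM M q)) = ∑ j, eval (M.mulVec v) (pderiv j q) * M j i := by
  induction q using MvPolynomial.induction_on with
  | C a => simp [substM]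
  | add p q hp hq =>
    have : substM M (p + q) = substM M p + substM M q := by simp [substM]
    simp only [this, map_add, hp, hq, add_mul, Finset.sum_add_distrib]
  | mul_X p l hp =>
    have : substM M (p * X l) = substM M p * ∑ j : Fin 3, C (M l j) * X j := by simp [substM]
    have h1 : eval v (pderiv i (∑ j : Fin 3, C (M l j) * X j)) = M l i := by
      fin_cases i <;> simp [Fin.sum_univ_three, pderiv_X]
    have h2 : eval v (∑ j : Fin 3, C (M l j) * X j) = M.mulVec v l := by
      simp [Matrix.mulVec, dotProduct]
    rw [this, pderiv_mul, map_add, map_mul, map_mul, h1, h2, hp, eval_substM]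
    simp only [pderiv_mul, map_add, map_mul, eval_X, add_mul, Finset.sum_add_distrib]
    congr 1
    · rw [Finset.sum_mul]; exact Finset.sum_congr rfl fun j _ => by ring
    · rw [Finset.sum_eq_single l]
      · simp
      · intro b _ hb
        simp [pderiv_X_of_ne hb.symm]
      · simp

lemma homog_substM (M : Matrix (Fin 3) (Fin 3) k) (q : MvPolynomial (Fin 3) k)
    (hq : q.IsHomogeneous 4) : (substM M q).IsHomogeneous 4 := by
  unfold substM
  have := hq.aeval (fun i => ∑ j : Fin 3, C (M i j) * X j) (n := 1) (fun i => by
    refine IsHomogeneous.sum _ _ _ fun j _ => ?_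
    exact isHomogeneous_C_mul_X _ _)
  simpa using this

lemma exists_frame (p : Fin 3 → k) (hp : p ≠ 0) :
    ∃ M : Matrix (Fin 3) (Fin 3) k, M.det ≠ 0 ∧ ∀ i, M i 2 = p i := by
  by_cases h2 : p 2 = 0
  · by_cases h1 : p 1 = 0
    · have h0 : p 0 ≠ 0 := by
        intro h0
        exact hp (by ext i; fin_cases i <;> simp [h0, h1, h2])
      refine ⟨!![0, 0, p 0; 1, 0, p 1; 0, 1, p 2], ?_, ?_⟩
      · simp [Matrix.det_fin_three, h0]
      · intro i; fin_cases i <;> simp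
    · refine ⟨!![1, 0, p 0; 0, 0, p 1; 0, 1, p 2], ?_, ?_⟩
      · simp [Matrix.det_fin_three, h1]
      · intro i; fin_cases i <;> simp
  · refine ⟨!![1, 0, p 0; 0, 1, p 1; 0, 0, p 2], ?_, ?_⟩
    · simp [Matrix.det_fin_three, h2]
    · intro i; fin_cases i <;> simp

lemma in_span (d a b v : Fin 3 → k) (hd : d ≠ 0) (hab : LinearIndependent k ![a, b])
    (ha : dot3 d a = 0) (hb : dot3 d b = 0) (hv : dot3 d v = 0) :
    ∃ γ δ : k, v = γ • a + δ • b := by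
  have hdet : (Matrix.of ![a, b, v]).det = 0 := by
    rw [← Matrix.exists_mulVec_eq_zero_iff]
    refine ⟨d, hd, ?_⟩
    simp only [dot3] at ha hb hv
    ext i
    fin_cases i <;> simp [Matrix.mulVec, dotProduct, Fin.sum_univ_three]
    · linear_combination ha
    · linear_combination hb
    · linear_combination hv
  rw [← Matrix.exists_vecMul_eq_zero_iff] at hdet
  obtain ⟨w, hw, h⟩ := hdet
  have h' : w 0 • a + w 1 • b + w 2 • v = 0 := by
    ext i
    have := congrFun h i
    simpa [Matrix.vecMul, dotProduct, Fin.sum_univ_three] using this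
  have hw2 : w 2 ≠ 0 := by
    intro h2
    rw [LinearIndependent.pair_iff] at hab
    have := hab (w 0) (w 1) (by simpa [h2] using h')
    exact hw (by ext i; fin_cases i <;> simp [this.1, this.2, h2])
  refine ⟨-(w 0 / w 2), -(w 1 / w 2), ?_⟩
  ext i
  have := congrFun h' i
  simp at this ⊢
  field_simp
  linear_combination this

lemma eval_restrict (q : MvPolynomial (Fin 3) k) (a b : Fin 3 → k) (s t : k) :
    eval ![s, t] (restrictLine q a b) = eval (s • a + t • b) q := by
  unfold restrictLine
  induction q using MvPolynomial.induction_on with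
  | C a => simp
  | add p q hp hq => simp only [map_add, hp, hq]
  | mul_X p i hp =>
    simp only [map_mul, hp, aeval_X, eval_X]
    congr 1
    simp; ring

lemma eval_lin (L : MvPolynomial (Fin 2) k) (hL : L.IsHomogeneous 1) :
    ∃ l m : k, ∀ s t, eval ![s, t] L = l * s + m * t := by
  rw [L.as_sum]
  refine Finset.sum_induction _
    (fun r => ∃ l m : k, ∀ s t, eval ![s, t] r = l * s + m * t) ?_ ?_ ?_
  · rintro a b ⟨l, m, h⟩ ⟨l', m', h'⟩
    exact ⟨l + l', m + m', fun s t => by rw [map_add, h, h']; ring⟩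
  · exact ⟨0, 0, by simp⟩
  · intro m hm
    have := hL (mem_support_iff.mp hm)
    rw [Finsupp.weight_apply, Finsupp.sum_fintype _ _ (by simp), Fin.sum_univ_two] at this
    simp at this
    have hcase : (m 0 = 1 ∧ m 1 = 0) ∨ (m 0 = 0 ∧ m 1 = 1) := by omega
    rcases hcase with ⟨h0, h1⟩ | ⟨h0, h1⟩
    · refine ⟨coeff m L, 0, fun s t => ?_⟩
      rw [eval_monomial, Finsupp.prod_fintype _ _ (by simp), Fin.prod_univ_two, h0, h1]
      simp
    · refine ⟨0, coeff m L, fun s t => ?_⟩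
      rw [eval_monomial, Finsupp.prod_fintype _ _ (by simp), Fin.prod_univ_two, h0, h1]
      simp

lemma infl_param (q : MvPolynomial (Fin 3) k) (d p v : Fin 3 → k) (h : IsInflectionLine q d)
    (hp : dot3 d p = 0) (hv : dot3 d v = 0) :
    ∃ l1 l2 m1 m2 : k, ∀ z : k, eval (z • p + v) q = (l1 * z + l2) ^ 3 * (m1 * z + m2) := by
  obtain ⟨hd, a, b, hab, ha, hb, L, M, hL, hM, -, hf⟩ := h
  obtain ⟨α, β, rfl⟩ := in_span d a b p hd hab ha hb hp
  obtain ⟨γ, δ, rfl⟩ := in_span d a b v hd hab ha hb hv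
  obtain ⟨l, l', hl⟩ := eval_lin L hL
  obtain ⟨m, m', hm⟩ := eval_lin M hM
  refine ⟨l * α + l' * β, l * γ + l' * δ, m * α + m' * β, m * γ + m' * δ, fun z => ?_⟩
  have e : z • (α • a + β • b) + (γ • a + δ • b) = (z * α + γ) • a + (z * β + δ) • b := by
    ext i; simp; ring
  rw [e, ← eval_restrict, hf, map_mul, map_pow, hl, hm]
  ring

lemma coef_eq [Infinite k] (a b c d e a' b' c' d' e' : k)
    (h : ∀ z : k, a * z ^ 4 + b * z ^ 3 + c * z ^ 2 + d * z + e
      = a' * z ^ 4 + b' * z ^ 3 + c' * z ^ 2 + d' * z + e') :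
    a = a' ∧ b = b' ∧ c = c' ∧ d = d' ∧ e = e' := by
  have hP : (Polynomial.C a * Polynomial.X ^ 4 + Polynomial.C b * Polynomial.X ^ 3
      + Polynomial.C c * Polynomial.X ^ 2 + Polynomial.C d * Polynomial.X + Polynomial.C e)
      = (Polynomial.C a' * Polynomial.X ^ 4 + Polynomial.C b' * Polynomial.X ^ 3
      + Polynomial.C c' * Polynomial.X ^ 2 + Polynomial.C d' * Polynomial.X
      + Polynomial.C e') := by
    apply Polynomial.funext
    intro z
    simpa using h z
  have hc := fun n => congrArg (fun P => Polynomial.coeff P n) hP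
  refine ⟨?_, ?_, ?_, ?_, ?_⟩
  · simpa [Polynomial.coeff_X, Polynomial.coeff_C] using hc 4
  · simpa [Polynomial.coeff_X, Polynomial.coeff_C] using hc 3
  · simpa [Polynomial.coeff_X, Polynomial.coeff_C] using hc 2
  · simpa [Polynomial.coeff_X, Polynomial.coeff_C] using hc 1
  · simpa [Polynomial.coeff_X, Polynomial.coeff_C] using hc 0

lemma eval_quart (c : Fin 15 → k) (x y z : k) : eval ![x, y, z] (quart c) =
    c 0 * z ^ 4 + g1 c x y * z ^ 3 + g2 c x y * z ^ 2 + g3 c x y * z + g4 c x y := by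
  simp [quart, g1, g2, g3, g4]

lemma infl_trip [Infinite k] (q : MvPolynomial (Fin 3) k) (M : Matrix (Fin 3) (Fin 3) k)
    (c : Fin 15 → k)
    (hc : substM M q = quart c) (d : Fin 3 → k) (h : IsInflectionLine q d)
    (hp : dot3 d (fun i => M i 2) = 0) (t : k)
    (hv : dot3 d (fun i => t * M i 0 + M i 1) = 0) :
    Trip (c 0) (g1 c t 1) (g2 c t 1) (g3 c t 1) (g4 c t 1) := by
  obtain ⟨l1, l2, m1, m2, hl⟩ := infl_param q d _ _ h hp hv
  refine ⟨l1, l2, m1, m2, coef_eq _ _ _ _ _ _ _ _ _ _ fun z => ?_⟩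
  rw [← eval_quart, ← hc, eval_substM]
  have : M.mulVec ![t, 1, z] = z • (fun i => M i 2) + (fun i => t * M i 0 + M i 1) := by
    ext i
    simp [Matrix.mulVec, dotProduct, Fin.sum_univ_three]
    ring
  rw [this, hl]
  ring

lemma proj_eq (ℓ ℓ' : Projectivization k (Fin 3 → k)) (r : k) (h : r • ℓ'.rep = ℓ.rep) :
    ℓ = ℓ' := by
  rw [← ℓ.mk_rep, ← ℓ'.mk_rep, Projectivization.mk_eq_mk_iff']
  exact ⟨r, h⟩

end geom

/-- A smooth plane quartic over an algebraically closed field admits at most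
`8` distinct inflection lines through any given point `p` of the plane. -/
theorem stmt11 {k : Type*} [Field k] [IsAlgClosed k]
    (q : MvPolynomial (Fin 3) k) (hq0 : q ≠ 0) (hq4 : q.IsHomogeneous 4)
    (hsm : ∀ pt : Fin 3 → k, pt ≠ 0 → eval pt q = 0 → ∃ i, eval pt (pderiv i q) ≠ 0)
    (p : Fin 3 → k) (hp : p ≠ 0) :
    {ℓ : Projectivization k (Fin 3 → k) |
        dot3 ℓ.rep p = 0 ∧ IsInflectionLine q ℓ.rep}.Finite ∧
    {ℓ : Projectivization k (Fin 3 → k) |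
        dot3 ℓ.rep p = 0 ∧ IsInflectionLine q ℓ.rep}.ncard ≤ 8 := by
  classical
  obtain ⟨M, hM, hMp⟩ := exists_frame p hp
  obtain ⟨c, hc⟩ := exists_quart _ (homog_substM M q hq4)
  have hs : SmoothC c := by
    apply smooth_quart
    rw [← hc]
    intro pt hpt h0
    rw [eval_substM] at h0
    obtain ⟨j, hj⟩ := hsm (M.mulVec pt)
      (fun h => hpt (Matrix.eq_zero_of_mulVec_eq_zero hM h)) h0
    by_contra! hall
    have : Matrix.vecMul (fun j => eval (M.mulVec pt) (pderiv j q)) M = 0 := by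
      ext i
      have := hall i
      rw [pderiv_substM] at this
      simpa [Matrix.vecMul, dotProduct] using this
    exact hj (congrFun (Matrix.eq_zero_of_vecMul_eq_zero hM this) j)
  obtain ⟨P, hP, hd, he⟩ := core c hs
  have hpM : (fun i => M i 2) = p := funext hMp
  set A := {ℓ : Projectivization k (Fin 3 → k) |
        dot3 ℓ.rep p = 0 ∧ IsInflectionLine q ℓ.rep} with hA
  -- coordinates of a line in the frame
  let w : Fin 3 → Projectivization k (Fin 3 → k) → k := fun j ℓ => Matrix.vecMul ℓ.rep M j
  have hw : ∀ j ℓ, w j ℓ = ℓ.rep 0 * M 0 j + ℓ.rep 1 * M 1 j + ℓ.rep 2 * M 2 j := by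
    intro j ℓ
    simp [w, Matrix.vecMul, dotProduct, Fin.sum_univ_three]
  have hinj : ∀ ℓ ℓ' : Projectivization k (Fin 3 → k), ∀ r : k,
      (∀ j, r * w j ℓ' = w j ℓ) → ℓ = ℓ' := by
    intro ℓ ℓ' r h
    apply proj_eq ℓ ℓ' r
    rw [← sub_eq_zero]
    apply Matrix.eq_zero_of_vecMul_eq_zero hM
    rw [Matrix.sub_vecMul, Matrix.smul_vecMul, sub_eq_zero]
    ext j
    simpa [w] using h j
  have hw2 : ∀ ℓ ∈ A, w 2 ℓ = 0 := by
    intro ℓ hℓ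
    rw [hw, hMp, hMp, hMp]
    exact hℓ.1
  have hwne : ∀ ℓ ∈ A, w 0 ℓ = 0 → w 1 ℓ ≠ 0 := by
    intro ℓ hℓ h0 h1
    apply ℓ.rep_nonzero
    apply Matrix.eq_zero_of_vecMul_eq_zero hM
    ext j
    fin_cases j
    · exact h0
    · exact h1
    · exact hw2 ℓ hℓ
  let φ : Projectivization k (Fin 3 → k) → Option k := fun ℓ =>
    if w 0 ℓ = 0 then none else some (-(w 1 ℓ / w 0 ℓ))
  have hφA : ∀ ℓ ∈ A, φ ℓ ∈ ((Finset.insertNone P.roots.toFinset : Finset (Option k)) :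
      Set (Option k)) := by
    intro ℓ hℓ
    by_cases h0 : w 0 ℓ = 0
    · simp [φ, h0]
    · have hroot : P.eval (-(w 1 ℓ / w 0 ℓ)) = 0 := by
        apply he
        refine infl_trip q M c hc ℓ.rep hℓ.2 (by rw [hpM]; exact hℓ.1) _ ?_
        have e0 := hw 0 ℓ
        have e1 := hw 1 ℓ
        have : dot3 ℓ.rep (fun i => -(w 1 ℓ / w 0 ℓ) * M i 0 + M i 1)
            = -(w 1 ℓ / w 0 ℓ) * w 0 ℓ + w 1 ℓ := by
          simp only [dot3]
          linear_combination (w 1 ℓ / w 0 ℓ) * e0 - e1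
        rw [this]
        field_simp
        ring
      simp [φ, h0, hP, hroot]
  have hφinj : Set.InjOn φ A := by
    intro ℓ hℓ ℓ' hℓ' h
    by_cases h0 : w 0 ℓ = 0
    · by_cases h0' : w 0 ℓ' = 0
      · have n1 := hwne ℓ' hℓ' h0'
        refine hinj ℓ ℓ' (w 1 ℓ / w 1 ℓ') fun j => ?_
        fin_cases j
        · simp [h0, h0']
        · simp [n1]
        · simp [hw2 ℓ hℓ, hw2 ℓ' hℓ']
      · simp [φ, h0, h0'] at h
    · by_cases h0' : w 0 ℓ' = 0
      · simp [φ, h0, h0'] at h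
      · simp [φ, h0, h0'] at h
        refine hinj ℓ ℓ' (w 0 ℓ / w 0 ℓ') fun j => ?_
        fin_cases j
        · simp [h0']
        · simp
          field_simp at h ⊢
          linear_combination -h
        · simp [hw2 ℓ hℓ, hw2 ℓ' hℓ']
  refine ⟨Set.Finite.of_injOn hφA hφinj (Finset.finite_toSet _), ?_⟩
  refine (Set.ncard_le_ncard_of_injOn φ hφA hφinj (Finset.finite_toSet _)).trans ?_
  rw [Set.ncard_coe_finset, Finset.card_insertNone]
  have h1 := Multiset.toFinset_card_le P.roots
  have h2 := P.card_roots'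
  omega
end
end
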